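/- Let I ⊆ R be a nonzero, proper S_n-invariant monomial ideal. Then the set of extremal pairs in the Betti table of R/I equals {(n−ℓ(ρ), ρ̃) : ρ ∈ Λ*_max(I)}. Moreover, if (i,λ) = (n−ℓ(ρ), ρ̃) is the extremal pair associated to ρ = (∞^{p_0},d_1^{p_1},…,d_s^{p_s}) ∈ Λ*_max(I) (with ∞ > d_1 > ⋯ > d_s ≥ 0), then the corresponding extremal Betti number is β_{i,λ}(R/I) = C(p_0+p_1−1, p_0). -/

import Mathlib

open scoped BigOperators

noncomputable section
open Classical

/-! ## Generic (labeled) simplicial chain complexes and reduced homology over a field -/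

section Homology

variable (K : Type) [Field K] {α : Type}

/-- Index type for chains: elements of `S` whose face (second component) has `j` elements. -/
def ChainIdx (S : Set (α × Finset ℕ)) (j : ℕ) : Type :=
  {q : α × Finset ℕ // q ∈ S ∧ q.2.card = j}

/-- The boundary of a basis element, with the usual simplicial signs. -/
noncomputable def bdElt (S : Set (α × Finset ℕ)) (j : ℕ) (q : ChainIdx S (j + 1)) :
    ChainIdx S j →₀ K :=
  ∑ v ∈ q.1.2,
    if h : (q.1.1, q.1.2.erase v) ∈ S ∧ (q.1.2.erase v).card = j then
      ((-1 : K) ^ (q.1.2.filter (fun u => u ≤ v)).card) •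
        Finsupp.single (⟨(q.1.1, q.1.2.erase v), h⟩ : ChainIdx S j) (1 : K)
    else 0

/-- The simplicial boundary map. -/
noncomputable def bd (S : Set (α × Finset ℕ)) (j : ℕ) :
    (ChainIdx S (j + 1) →₀ K) →ₗ[K] (ChainIdx S j →₀ K) :=
  Finsupp.linearCombination K (bdElt K S j)

/-- Cycles in homological degree `j` (chains are indexed by the cardinality of faces;
degree `j` corresponds to reduced topological degree `j - 1`). -/
noncomputable def cycles (S : Set (α × Finset ℕ)) : (j : ℕ) → Submodule K (ChainIdx S j →₀ K)
  | 0 => ⊤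
  | (i + 1) => LinearMap.ker (bd K S i)

/-- `rhd K S j` is the dimension of the reduced homology group `H̃_{j-1}` of the complex `S`
(the chain groups being finite dimensional, this is `dim` cycles `- dim` boundaries). -/
noncomputable def rhd (S : Set (α × Finset ℕ)) (j : ℕ) : ℕ :=
  Module.finrank K (cycles K S j) -
    Module.finrank K (LinearMap.range (bd K S j) ⊓ cycles K S j : Submodule K _)

/-- `hdim K S j = dim_K H̃_j(S; K)`, for `j : ℤ` (zero for `j ≤ -2`). -/
noncomputable def hdim (S : Set (α × Finset ℕ)) (j : ℤ) : ℕ :=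
  if 0 ≤ j + 1 then rhd K S (j + 1).toNat else 0

/-- View an unlabeled collection of faces as a labeled one (labels in `Unit`). -/
def lab (Δ : Set (Finset ℕ)) : Set (Unit × Finset ℕ) := {q | q.2 ∈ Δ}

/-- Dimension of reduced homology `H̃_{j-1}(Δ; K)` of a collection `Δ` of finite sets. -/
noncomputable def rhd0 (Δ : Set (Finset ℕ)) (j : ℕ) : ℕ := rhd K (lab Δ) j

/-- Dimension of reduced homology `H̃_j(Δ; K)`, `j : ℤ`. -/
noncomputable def hdim0 (Δ : Set (Finset ℕ)) (j : ℤ) : ℕ := hdim K (lab Δ) j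

end Homology

/-! ## Monomial ideals in `k[x_1, …, x_n]`, invariant under the symmetric group -/

section Poly

variable (K : Type) [Field K] (n : ℕ)

/-- The monomial `x^a` in `k[x_1, …, x_n]`. -/
noncomputable def mon (a : Fin n → ℕ) : MvPolynomial (Fin n) K :=
  MvPolynomial.monomial (Finsupp.equivFunOnFinite.symm a) 1

/-- A monomial ideal: an ideal generated by a set of monomials. -/
def IsMonomialIdeal (I : Ideal (MvPolynomial (Fin n) K)) : Prop :=
  ∃ S : Set (Fin n → ℕ), I = Ideal.span (mon K n '' S)

/-- `I` is invariant under the action of `S_n` permuting the variables. -/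
def IsSymmetricIdeal (I : Ideal (MvPolynomial (Fin n) K)) : Prop :=
  ∀ σ : Equiv.Perm (Fin n), Ideal.map (MvPolynomial.rename σ).toRingHom I = I

end Poly

/-! ## Partitions given by blocks `(d_1^{p_1}, …, d_s^{p_s}, 0^{p_{s+1}})` -/

section Blocks

/-- `cumsum p k = p 0 + ⋯ + p (k-1)`. -/
def cumsum (p : ℕ → ℕ) (k : ℕ) : ℕ := ∑ j ∈ Finset.range k, p j

/-- The index of the block (among blocks `0, …, s`) containing position `i`,
for blocks of sizes `p 0, …, p (s-1)` followed by a final block. -/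
def blkOf (p : ℕ → ℕ) (s i : ℕ) : ℕ :=
  ((Finset.range s).filter fun k => cumsum p (k + 1) ≤ i).card

/-- The partition `μ = (d_0^{p_0}, …, d_{s-1}^{p_{s-1}}, 0^{p_s})` (0-indexed blocks),
as a function of the position `i ∈ {0, …, n-1}` where `n = cumsum p (s+1)`. -/
def muOf (s : ℕ) (d p : ℕ → ℕ) (i : ℕ) : ℕ :=
  if blkOf p s i < s then d (blkOf p s i) else 0

/-- The partition `μ ∖ c`, obtained from `μ` by replacing, for each `k`, the last `c k` of
the parts equal to `d k` by `d k - 1`. -/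
def muMinus (s : ℕ) (d p c : ℕ → ℕ) (i : ℕ) : ℕ :=
  if blkOf p s i < s then
    (if p (blkOf p s i) - c (blkOf p s i) ≤ i - cumsum p (blkOf p s i) then
      d (blkOf p s i) - 1 else d (blkOf p s i))
  else 0

/-- Indicator vector of a finite set `F`. -/
def eF (F : Finset ℕ) (j : ℕ) : ℕ := if j ∈ F then 1 else 0

end Blocks

/-! ## The simplicial complexes `Δ^{μ,c}(I)` and `Γ^{μ,c}(I)` -/

section Complexes

variable (K : Type) [Field K] (n : ℕ)

/-- The simplicial complex `Δ^{μ,c}(I) = {F ⊆ [s] : μ ∖ (c + e_F) ∈ P(I)}` (vertices are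
`0, …, s-1`), for `μ = (d_0^{p_0}, …, d_{s-1}^{p_{s-1}}, 0^{p_s})` and `c ≤ p(μ)`. -/
def DeltaCx (I : Ideal (MvPolynomial (Fin n) K)) (s : ℕ) (d p c : ℕ → ℕ) :
    Set (Finset ℕ) :=
  {F | F ⊆ Finset.range s ∧
    mon K n (fun i => muMinus s d p (fun j => c j + eF F j) i.val) ∈ I}

/-- The Alexander dual complex `Γ^{μ,c}(I) = {F ⊆ [s] : μ ∖ (c + e_{[s]∖F}) ∈ O(I)}`. -/
def GammaCx (I : Ideal (MvPolynomial (Fin n) K)) (s : ℕ) (d p c : ℕ → ℕ) :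
    Set (Finset ℕ) :=
  {F | F ⊆ Finset.range s ∧
    mon K n (fun i => muMinus s d p
      (fun j => c j + (if j < s ∧ j ∉ F then 1 else 0)) i.val) ∉ I}

/-- `γ_i^{μ,c}(I) = dim_K H̃_{i-1}(Δ^{μ,c}(I); K)`. -/
noncomputable def gammaDim (I : Ideal (MvPolynomial (Fin n) K)) (s : ℕ) (d p c : ℕ → ℕ)
    (i : ℕ) : ℕ :=
  rhd0 K (DeltaCx K n I s d p c) i

end Complexes

/-! ## Multigraded Tor via the Koszul complex

For a monomial ideal `I`, the multidegree-`a` strand of the Koszul complex `K_•(I)` is the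
(shifted) reduced chain complex of the simplicial complex
`Δ_a^I = {F ⊆ [n] : a - e_F ≥ 0, x^{a - e_F} ∈ I}`, so that
`dim_K Tor_i(I, K)_a = dim_K H̃_{i-1}(Δ_a^I; K)`, and similarly for `R/I` with the
condition `x^{a-e_F} ∉ I`. -/

section Tor

variable (K : Type) [Field K] (n : ℕ)

/-- The Koszul simplicial complex of the ideal `I` in multidegree `a`. -/
def KosI (I : Ideal (MvPolynomial (Fin n) K)) (a : Fin n → ℕ) : Set (Finset ℕ) :=
  {F | F ⊆ Finset.range n ∧ (∀ i : Fin n, (i : ℕ) ∈ F → 1 ≤ a i) ∧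
    mon K n (fun i => a i - eF F i.val) ∈ I}

/-- The Koszul complex of `R/I` in multidegree `a`. -/
def KosQ (I : Ideal (MvPolynomial (Fin n) K)) (a : Fin n → ℕ) : Set (Finset ℕ) :=
  {F | F ⊆ Finset.range n ∧ (∀ i : Fin n, (i : ℕ) ∈ F → 1 ≤ a i) ∧
    mon K n (fun i => a i - eF F i.val) ∉ I}

/-- `dim_K Tor_i(I, K)_a`, for a monomial ideal `I` and a multidegree `a ∈ ℤ^n`
(components with a negative coordinate vanish, so only `a ∈ ℕ^n` is needed). -/
noncomputable def torDim (I : Ideal (MvPolynomial (Fin n) K)) (i : ℕ) (a : Fin n → ℕ) : ℕ :=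
  rhd0 K (KosI K n I a) i

/-- `dim_K Tor_i(R/I, K)_a` for a monomial ideal `I`. -/
noncomputable def torQDim (I : Ideal (MvPolynomial (Fin n) K)) (i : ℕ) (a : Fin n → ℕ) : ℕ :=
  rhd0 K (KosQ K n I a) i

/-- `dim_K Tor_i(I, K)_{⟨μ⟩}`: the sum of `dim_K Tor_i(I, K)_a` over all rearrangements `a`
of the partition `μ`. -/
noncomputable def torDimSym (I : Ideal (MvPolynomial (Fin n) K)) (i : ℕ) (μ : Fin n → ℕ) : ℕ :=
  ∑ a ∈ Finset.image (fun σ : Equiv.Perm (Fin n) => μ ∘ σ) Finset.univ, torDim K n I i a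

/-- `dim_K Tor_i(R/I, K)_{⟨μ⟩}`. -/
noncomputable def torQDimSym (I : Ideal (MvPolynomial (Fin n) K)) (i : ℕ) (μ : Fin n → ℕ) : ℕ :=
  ∑ a ∈ Finset.image (fun σ : Equiv.Perm (Fin n) => μ ∘ σ) Finset.univ, torQDim K n I i a

end Tor

/-! ## Extended partitions in `P_n^∞` and the dual generators of an `S_n`-invariant
monomial ideal -/

section ExtendedPartitions

variable (K : Type) [Field K] (n : ℕ)

/-- `ℓ(μ)`: the number of entries of `μ ∈ P_n^∞` equal to `∞`. -/
def ellInf (μ : Fin n → ℕ∞) : ℕ := (Finset.univ.filter fun i => μ i = ⊤).card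

/-- The largest finite entry of `μ ∈ P_n^∞` (i.e. the first finite entry, `μ` being
weakly decreasing). -/
def topVal (μ : Fin n → ℕ∞) : ℕ := Finset.univ.sup fun i => (μ i).toNat

/-- `μ^+ ∈ P_n`: each `∞` entry of `μ` is replaced by (largest finite entry)` + 1`. -/
def plusOf (μ : Fin n → ℕ∞) (i : Fin n) : ℕ :=
  if μ i = ⊤ then topVal n μ + 1 else (μ i).toNat

/-- `μ̃ = μ^+ + (0^{ℓ(μ)}, 1^{n - ℓ(μ)}) ∈ P_n`. -/
def tildeOf (μ : Fin n → ℕ∞) (i : Fin n) : ℕ :=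
  if μ i = ⊤ then topVal n μ + 1 else (μ i).toNat + 1

/-- The ideal `Q_μ = ∩_{σ ∈ S_n} σ((x_k^{μ_k + 1}, …, x_n^{μ_n + 1}))`, where
`μ_k, …, μ_n` are the finite entries of `μ ∈ P_n^∞`. -/
noncomputable def Qgen (μ : Fin n → ℕ∞) : Ideal (MvPolynomial (Fin n) K) :=
  ⨅ σ : Equiv.Perm (Fin n),
    Ideal.map (MvPolynomial.rename σ).toRingHom
      (Ideal.span {g | ∃ i : Fin n, μ i ≠ ⊤ ∧ g = MvPolynomial.X i ^ ((μ i).toNat + 1)})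

/-- `Λ` is the (finite) set of dual generators of `I`, i.e. `I = ∩_{μ ∈ Λ} Q_μ` is the
irredundant presentation of `I` by ideals `Q_μ`. -/
def IsDualPresentation (I : Ideal (MvPolynomial (Fin n) K))
    (Λ : Finset (Fin n → ℕ∞)) : Prop :=
  (∀ μ ∈ Λ, Antitone μ) ∧ (I = ⨅ μ ∈ Λ, Qgen K n μ) ∧
    ∀ μ ∈ Λ, I ≠ ⨅ ρ ∈ Λ, ⨅ _ : ρ ≠ μ, Qgen K n ρ

/-- The partial order `≼` on dual generators: `μ ≼ ρ` iff `μ̃ ≤ ρ̃` (componentwise) and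
`ℓ(μ) - ℓ(ρ) ≤ |ρ̃| - |μ̃|`. -/
def preceq (μ ρ : Fin n → ℕ∞) : Prop :=
  (∀ i, tildeOf n μ i ≤ tildeOf n ρ i) ∧
    (∑ i, tildeOf n μ i) + ellInf n μ ≤ (∑ i, tildeOf n ρ i) + ellInf n ρ

/-- The extended partition `ρ = (∞^{p_0}, d_1^{p_1}, …, d_s^{p_s}) ∈ P_n^∞`
(so `n = p 0 + p 1 + ⋯ + p s`), as a function of the position `i ∈ {0, …, n-1}`. -/
def rhoOf (s : ℕ) (d p : ℕ → ℕ) (i : ℕ) : ℕ∞ :=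
  if blkOf p (s + 1) i = 0 then ⊤ else ((d (blkOf p (s + 1) i) : ℕ) : ℕ∞)

end ExtendedPartitions

/-- `(i, λ) ∈ [n] × P_n` is an extremal pair in the Betti table of `R/I`:
`Tor_i(R/I, k)_{⟨λ⟩} ≠ 0`, and `Tor_j(R/I, k)_{⟨μ⟩} = 0` for all `j ≥ i` and all
partitions `μ ≩ λ` with `|μ| - j ≥ |λ| - i`. -/
def IsExtremalPair (K : Type) [Field K] (n : ℕ) (I : Ideal (MvPolynomial (Fin n) K))
    (i : ℕ) (l : Fin n → ℕ) : Prop :=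
  1 ≤ i ∧ i ≤ n ∧ Antitone l ∧ torQDimSym K n I i l ≠ 0 ∧
    ∀ (j : ℕ) (μ : Fin n → ℕ), i ≤ j → Antitone μ → (∀ t, l t ≤ μ t) → l ≠ μ →
      ((∑ t, (l t : ℤ)) - i ≤ (∑ t, (μ t : ℤ)) - j) → torQDimSym K n I j μ = 0

/-! ## Cone homotopies -/

section Cone

variable (K : Type) [Field K]

/-- The simplicial boundary on the full simplex with vertex set `ℕ`, restricted to the faces
obtained by removing a vertex in `A`. -/
def partialBd (A : Finset ℕ) : (Finset ℕ →₀ K) →ₗ[K] (Finset ℕ →₀ K) :=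
  Finsupp.linearCombination K fun F =>
    ∑ u ∈ F ∩ A, (-1 : K) ^ (F.filter (fun w => w ≤ u)).card • Finsupp.single (F.erase u) (1 : K)

/-- Coning with apex `v`. -/
def coneMap (v : ℕ) : (Finset ℕ →₀ K) →ₗ[K] (Finset ℕ →₀ K) :=
  Finsupp.linearCombination K fun F =>
    if v ∈ F then 0 else
      (-1 : K) ^ ((insert v F).filter (fun w => w ≤ v)).card • Finsupp.single (insert v F) (1 : K)

lemma partialBd_single (A F : Finset ℕ) :
    partialBd K A (Finsupp.single F 1) =
      ∑ u ∈ F ∩ A, (-1 : K) ^ (F.filter (fun w => w ≤ u)).card •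
        Finsupp.single (F.erase u) (1 : K) := by
  simp [partialBd]

lemma coneMap_single_of_mem {v : ℕ} {F : Finset ℕ} (h : v ∈ F) :
    coneMap K v (Finsupp.single F 1) = 0 := by
  simp [coneMap, h]

lemma coneMap_single_of_notMem {v : ℕ} {F : Finset ℕ} (h : v ∉ F) :
    coneMap K v (Finsupp.single F 1) =
      (-1 : K) ^ ((insert v F).filter (fun w => w ≤ v)).card •
        Finsupp.single (insert v F) (1 : K) := by
  simp [coneMap, h]

lemma cone_sign {v u : ℕ} {F : Finset ℕ} (hv : v ∉ F) (hu : u ∈ F) :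
    (-1 : K) ^ ((insert v F).filter (fun w => w ≤ v)).card *
        (-1 : K) ^ ((insert v F).filter (fun w => w ≤ u)).card +
      (-1 : K) ^ (F.filter (fun w => w ≤ u)).card *
        (-1 : K) ^ ((insert v (F.erase u)).filter (fun w => w ≤ v)).card = 0 := by
  have huv : u ≠ v := fun h => hv (h ▸ hu)
  have hv' : v ∉ F.erase u := fun h => hv (Finset.mem_of_mem_erase h)
  rcases lt_or_gt_of_ne huv with h | h
  · have e1 : ((insert v F).filter (fun w => w ≤ u)) = F.filter (fun w => w ≤ u) := by
      rw [Finset.filter_insert, if_neg (by omega)]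
    have e2 : ((insert v F).filter (fun w => w ≤ v)).card =
        ((insert v (F.erase u)).filter (fun w => w ≤ v)).card + 1 := by
      have : ((insert v (F.erase u)).filter (fun w => w ≤ v)) =
          ((insert v F).filter (fun w => w ≤ v)).erase u := by
        ext w
        simp only [Finset.mem_filter, Finset.mem_insert, Finset.mem_erase]
        constructor
        · rintro ⟨rfl | ⟨h1, h2⟩, h3⟩
          · exact ⟨huv.symm, Or.inl rfl, h3⟩
          · exact ⟨h1, Or.inr h2, h3⟩
        · rintro ⟨h1, rfl | h2, h3⟩
          · exact ⟨Or.inl rfl, h3⟩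
          · exact ⟨Or.inr ⟨h1, h2⟩, h3⟩
      rw [this, Finset.card_erase_add_one]
      simp [hu, h.le]
    rw [e1, e2]
    ring
  · have e1 : ((insert v F).filter (fun w => w ≤ u)).card =
        (F.filter (fun w => w ≤ u)).card + 1 := by
      rw [Finset.filter_insert, if_pos h.le, Finset.card_insert_of_notMem]
      simp [hv]
    have e2 : ((insert v F).filter (fun w => w ≤ v)) =
        ((insert v (F.erase u)).filter (fun w => w ≤ v)) := by
      ext w
      simp only [Finset.mem_filter, Finset.mem_insert, Finset.mem_erase]
      constructor
      · rintro ⟨rfl | h2, h3⟩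
        · exact ⟨Or.inl rfl, h3⟩
        · exact ⟨Or.inr ⟨by omega, h2⟩, h3⟩
      · rintro ⟨rfl | ⟨h1, h2⟩, h3⟩
        · exact ⟨Or.inl rfl, h3⟩
        · exact ⟨Or.inr h2, h3⟩
    rw [e1, e2]
    ring

lemma neg_one_pow_mul_self (m : ℕ) : (-1 : K) ^ m * (-1 : K) ^ m = 1 := by
  rw [← mul_pow]; simp

lemma cone_homotopy {A : Finset ℕ} {v : ℕ} (hA : v ∈ A) (x : Finset ℕ →₀ K) :
    partialBd K A (coneMap K v x) + coneMap K v (partialBd K A x) = x := by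
  suffices h : (partialBd K A ∘ₗ coneMap K v + coneMap K v ∘ₗ partialBd K A) = LinearMap.id from
    LinearMap.congr_fun h x
  refine Finsupp.lhom_ext' fun F => LinearMap.ext_ring ?_
  simp only [LinearMap.coe_comp, Function.comp_apply, LinearMap.add_apply, LinearMap.id_coe, id,
    Finsupp.lsingle_apply]
  by_cases hv : v ∈ F
  · rw [coneMap_single_of_mem K hv, map_zero, zero_add, partialBd_single, map_sum,
      Finset.sum_eq_single v]
    · rw [map_smul, coneMap_single_of_notMem K (Finset.notMem_erase v F), Finset.insert_erase hv,
        smul_smul, neg_one_pow_mul_self, one_smul]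
    · intro u hu huv
      rw [map_smul, coneMap_single_of_mem K (Finset.mem_erase.2 ⟨huv.symm, hv⟩), smul_zero]
    · intro h
      exact absurd (Finset.mem_inter.2 ⟨hv, hA⟩) h
  · have hins : insert v F ∩ A = insert v (F ∩ A) := by
      rw [Finset.insert_inter_of_mem hA]
    have hv' : v ∉ F ∩ A := fun h => hv (Finset.mem_inter.1 h).1
    rw [coneMap_single_of_notMem K hv, map_smul, partialBd_single, partialBd_single, hins,
      Finset.sum_insert hv', Finset.erase_insert hv, smul_add, smul_smul, neg_one_pow_mul_self, one_smul,
      add_assoc, map_sum, Finset.smul_sum, ← Finset.sum_add_distrib]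
    convert add_zero _
    refine Finset.sum_eq_zero fun u hu => ?_
    have huF := (Finset.mem_inter.1 hu).1
    have huv : v ≠ u := fun h => hv (h ▸ huF)
    rw [map_smul, coneMap_single_of_notMem K (fun h => hv (Finset.mem_of_mem_erase h)),
      smul_smul, smul_smul, Finset.erase_insert_of_ne huv, ← add_smul, cone_sign K hv huF,
      zero_smul]

lemma partialBd_partialBd (A : Finset ℕ) (x : Finset ℕ →₀ K) :
    partialBd K A (partialBd K A x) = 0 := by
  suffices h : ∀ (m : ℕ) (F : Finset ℕ), F.card = m →
      partialBd K A (partialBd K A (Finsupp.single F 1)) = 0 by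
    suffices h' : (partialBd K A ∘ₗ partialBd K A) = 0 from LinearMap.congr_fun h' x
    exact Finsupp.lhom_ext' fun F => LinearMap.ext_ring (by simpa using h _ F rfl)
  intro m
  induction m with
  | zero =>
    intro F hF
    rw [Finset.card_eq_zero] at hF
    simp [partialBd_single, hF]
  | succ m ih =>
    intro F hF
    by_cases hFA : (F ∩ A).Nonempty
    · obtain ⟨v, hv⟩ := hFA
      obtain ⟨hvF, hvA⟩ := Finset.mem_inter.1 hv
      have h0 := ih (F.erase v) (by rw [Finset.card_erase_of_mem hvF, hF]; rfl)
      set G : Finset ℕ →₀ K := Finsupp.single (F.erase v) 1 with hG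
      have h1 := cone_homotopy K hvA G
      have h2 := cone_homotopy K hvA (partialBd K A G)
      rw [h0, map_zero, add_zero] at h2
      have h3 : partialBd K A (partialBd K A (coneMap K v G)) = 0 := by
        have := congrArg (partialBd K A) h1
        rw [map_add, h2] at this
        simpa using this
      rw [hG, coneMap_single_of_notMem K (Finset.notMem_erase v F), Finset.insert_erase hvF,
        map_smul, map_smul] at h3
      exact (smul_eq_zero.1 h3).resolve_left (pow_ne_zero _ (by simp))
    · rw [Finset.not_nonempty_iff_eq_empty] at hFA
      simp [partialBd_single, hFA]

lemma coneMap_apply (v : ℕ) (x : Finset ℕ →₀ K) (G : Finset ℕ) :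
    coneMap K v x G = if v ∈ G then
      (-1 : K) ^ (G.filter (fun w => w ≤ v)).card * x (G.erase v) else 0 := by
  induction x using Finsupp.induction_linear with
  | zero => simp
  | add f g hf hg => rw [map_add, Finsupp.add_apply, hf, hg]; split_ifs <;> simp [mul_add]
  | single F c =>
    rw [← mul_one c, ← smul_eq_mul, ← Finsupp.smul_single, map_smul]
    by_cases hv : v ∈ F
    · have : F ≠ G.erase v := fun h => by simp [h] at hv
      rw [coneMap_single_of_mem K hv]
      simp [this]
    · rw [coneMap_single_of_notMem K hv]
      by_cases hG : insert v F = G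
      · subst hG
        simp [Finset.erase_insert hv, mul_comm]
      · have : v ∈ G → F ≠ G.erase v := fun h h' => hG (by rw [h', Finset.insert_erase h])
        by_cases hvG : v ∈ G
        · simp [hG, hvG, this hvG]
        · simp [hG, hvG]

end Cone

section Restriction

variable (K : Type) [Field K]

/-- The face underlying a basis element of the chains of `Δ`. -/
def face {Δ : Set (Finset ℕ)} {j : ℕ} (q : ChainIdx (lab Δ) j) : Finset ℕ := q.1.2

/-- The basis element of the chains of `Δ` given by a face. -/
def ofFace {Δ : Set (Finset ℕ)} {j : ℕ} {F : Finset ℕ} (hF : F ∈ Δ) (hc : F.card = j) :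
    ChainIdx (lab Δ) j := ⟨((), F), hF, hc⟩

@[simp]
lemma face_ofFace {Δ : Set (Finset ℕ)} {j : ℕ} {F : Finset ℕ} (hF : F ∈ Δ) (hc : F.card = j) :
    face (ofFace hF hc) = F := rfl

lemma face_mem {Δ : Set (Finset ℕ)} {j : ℕ} (q : ChainIdx (lab Δ) j) : face q ∈ Δ := q.2.1

lemma card_face {Δ : Set (Finset ℕ)} {j : ℕ} (q : ChainIdx (lab Δ) j) : (face q).card = j := q.2.2

lemma face_injective (Δ : Set (Finset ℕ)) (j : ℕ) :
    Function.Injective (face : ChainIdx (lab Δ) j → Finset ℕ) :=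
  fun _ _ h => Subtype.ext (Prod.ext rfl h)

/-- The inclusion of the chains of `Δ` into the chains of the full simplex. -/
def chainIncl (Δ : Set (Finset ℕ)) (j : ℕ) :
    (ChainIdx (lab Δ) j →₀ K) →ₗ[K] (Finset ℕ →₀ K) :=
  Finsupp.lmapDomain K K face

lemma chainIncl_single {Δ : Set (Finset ℕ)} {j : ℕ} (q : ChainIdx (lab Δ) j) (c : K) :
    chainIncl K Δ j (Finsupp.single q c) = Finsupp.single (face q) c := by
  simp [chainIncl]

lemma chainIncl_apply {Δ : Set (Finset ℕ)} {j : ℕ} (z : ChainIdx (lab Δ) j →₀ K)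
    (q : ChainIdx (lab Δ) j) : chainIncl K Δ j z (face q) = z q :=
  Finsupp.mapDomain_apply (face_injective Δ j) z q

lemma chainIncl_apply_eq_zero {Δ : Set (Finset ℕ)} {j : ℕ} (z : ChainIdx (lab Δ) j →₀ K)
    {F : Finset ℕ} (hF : ¬ (F ∈ Δ ∧ F.card = j)) : chainIncl K Δ j z F = 0 := by
  refine Finsupp.mapDomain_of_notMem_range z F ?_
  rintro ⟨q, rfl⟩
  exact hF q.2

lemma exists_chainIncl_eq {Δ : Set (Finset ℕ)} {j : ℕ} (y : Finset ℕ →₀ K)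
    (hy : ∀ F, y F ≠ 0 → F ∈ Δ ∧ F.card = j) : ∃ z, chainIncl K Δ j z = y := by
  refine ⟨y.comapDomain _ (face_injective Δ j).injOn, ?_⟩
  ext F
  by_cases hF : F ∈ Δ ∧ F.card = j
  · exact (chainIncl_apply K _ (ofFace hF.1 hF.2)).trans (Finsupp.comapDomain_apply _ _ _ _)
  · rw [chainIncl_apply_eq_zero K _ hF]
    by_contra h
    exact hF (hy F (Ne.symm h))

lemma bdElt_apply {Δ : Set (Finset ℕ)} {j : ℕ} (p : ChainIdx (lab Δ) (j + 1))
    (q : ChainIdx (lab Δ) j) :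
    bdElt K (lab Δ) j p q = ∑ u ∈ face p, if (face p).erase u = face q then
      (-1 : K) ^ ((face p).filter (fun w => w ≤ u)).card else 0 := by
  rw [bdElt, Finsupp.finsetSum_apply]
  refine Finset.sum_congr rfl fun u hu => ?_
  by_cases h : (face p).erase u ∈ Δ ∧ ((face p).erase u).card = j
  · refine (congrArg (fun f : ChainIdx (lab Δ) j →₀ K => f q) (dif_pos h)).trans ?_
    change ((-1 : K) ^ ((face p).filter (fun w => w ≤ u)).card •
      Finsupp.single (ofFace h.1 h.2) (1 : K)) q = _
    rw [Finsupp.smul_apply, Finsupp.single_apply, smul_eq_mul, mul_ite, mul_one, mul_zero]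
    refine if_congr ?_ rfl rfl
    rw [← (face_injective Δ j).eq_iff, face_ofFace]
  · refine (congrArg (fun f : ChainIdx (lab Δ) j →₀ K => f q) (dif_neg h)).trans ?_
    rw [if_neg]
    · rfl
    · intro e
      exact h (e ▸ q.2)

lemma partialBd_single_apply (A F G : Finset ℕ) :
    partialBd K A (Finsupp.single F 1) G = ∑ u ∈ F ∩ A, if F.erase u = G then
      (-1 : K) ^ (F.filter (fun w => w ≤ u)).card else 0 := by
  rw [partialBd_single, Finsupp.finsetSum_apply]
  refine Finset.sum_congr rfl fun u _ => ?_
  rw [Finsupp.smul_apply, Finsupp.single_apply, smul_eq_mul, mul_ite, mul_one, mul_zero]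

lemma bd_single {Δ : Set (Finset ℕ)} {j : ℕ} (p : ChainIdx (lab Δ) (j + 1)) :
    bd K (lab Δ) j (Finsupp.single p 1) = bdElt K (lab Δ) j p := by
  rw [bd, Finsupp.linearCombination_single, one_smul]

lemma bd_apply {Δ : Set (Finset ℕ)} {j : ℕ} {A : Finset ℕ}
    (hA : ∀ F ∈ Δ, F.card = j + 1 → ∀ u ∈ F, F.erase u ∈ Δ → u ∈ A)
    (z : ChainIdx (lab Δ) (j + 1) →₀ K) (q : ChainIdx (lab Δ) j) :
    bd K (lab Δ) j z q = partialBd K A (chainIncl K Δ (j + 1) z) (face q) := by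
  induction z using Finsupp.induction_linear with
  | zero => simp
  | add f g hf hg => simp only [map_add, Finsupp.add_apply, hf, hg]
  | single p c =>
    rw [← mul_one c, ← smul_eq_mul, ← Finsupp.smul_single, map_smul, map_smul, map_smul,
      Finsupp.smul_apply, Finsupp.smul_apply, chainIncl_single, partialBd_single_apply,
      bd_single, bdElt_apply]
    congr 1
    symm
    refine Finset.sum_subset Finset.inter_subset_left fun u hu hu' => if_neg fun e => hu' ?_
    exact Finset.mem_inter.2 ⟨hu, hA _ (face_mem p) (card_face p) u hu (e ▸ face_mem q)⟩

/-- If the faces of cardinality `k + 1` are stable under adding and removing a vertex `v`, then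
the homology in the corresponding degree vanishes. -/
lemma rhd0_eq_zero_of_cone {Δ : Set (Finset ℕ)} {k v : ℕ} {N : Finset ℕ}
    (hN : ∀ F ∈ Δ, F ⊆ N) (hv : v ∈ N)
    (herase : ∀ F ∈ Δ, F.card = k + 1 → F.erase v ∈ Δ)
    (hinsert : ∀ F ∈ Δ, F.card = k + 1 → insert v F ∈ Δ) :
    rhd0 K Δ (k + 1) = 0 := by
  suffices h : cycles K (lab Δ) (k + 1) ≤ LinearMap.range (bd K (lab Δ) (k + 1)) by
    rw [rhd0, rhd, inf_eq_right.2 h, Nat.sub_self]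
  intro z hz
  have hbd : ∀ j, ∀ F ∈ Δ, F.card = j + 1 → ∀ u ∈ F, F.erase u ∈ Δ → u ∈ N :=
    fun _ F hF _ u hu _ => hN F hF hu
  have hz' : bd K (lab Δ) k z = 0 := hz
  obtain ⟨z', hz'⟩ := exists_chainIncl_eq K (Δ := Δ) (j := k + 2)
    (coneMap K v (chainIncl K Δ (k + 1) z)) (by
      intro F hF
      rw [coneMap_apply] at hF
      split_ifs at hF with hvF
      · have h := right_ne_zero_of_mul hF
        have h' : F.erase v ∈ Δ ∧ (F.erase v).card = k + 1 := by
          by_contra h'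
          exact h (chainIncl_apply_eq_zero K z h')
        have := hinsert _ h'.1 h'.2
        rw [Finset.insert_erase hvF] at this
        exact ⟨this, by rw [← Finset.card_erase_add_one hvF, h'.2]⟩
      · exact absurd rfl hF)
  refine ⟨z', ?_⟩
  ext q
  rw [bd_apply K (hbd _), hz']
  have h := DFunLike.congr_fun (cone_homotopy K hv (chainIncl K Δ (k + 1) z)) (face q)
  rw [Finsupp.add_apply, chainIncl_apply, coneMap_apply] at h
  rw [← h]
  split_ifs with hvq
  · have h0 : bd K (lab Δ) k z (ofFace (herase _ (face_mem q) (card_face q))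
        (by rw [Finset.card_erase_of_mem hvq, card_face q]; rfl)) = 0 := by
      rw [‹bd K (lab Δ) k z = 0›]; rfl
    rw [bd_apply K (hbd _), face_ofFace] at h0
    rw [h0, mul_zero, add_zero]
  · rw [add_zero]

lemma partialBd_apply_eq_zero {A B : Finset ℕ} {x : Finset ℕ →₀ K}
    (hx : ∀ F, B ⊆ F → x F = 0) {F : Finset ℕ} (hF : B ⊆ F) : partialBd K A x F = 0 := by
  have : x ∈ Finsupp.supported K K {F | ¬ B ⊆ F} := by
    rw [Finsupp.mem_supported']
    intro G hG
    exact hx G (not_not.1 hG)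
  clear hx
  rw [Finsupp.supported_eq_span_single] at this
  induction this using Submodule.span_induction with
  | mem y hy =>
    obtain ⟨G, hG, rfl⟩ := hy
    rw [partialBd_single, Finsupp.finsetSum_apply]
    refine Finset.sum_eq_zero fun u _ => ?_
    have : G.erase u ≠ F := fun e => hG ((e ▸ hF).trans (Finset.erase_subset _ _))
    simp [this]
  | zero => simp
  | add y y' _ _ h h' => rw [map_add, Finsupp.add_apply, h, h', add_zero]
  | smul a y _ h => rw [map_smul, Finsupp.smul_apply, h, smul_zero]

lemma exists_of_partialBd_ne_zero {A : Finset ℕ} {x : Finset ℕ →₀ K} {F : Finset ℕ}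
    (h : partialBd K A x F ≠ 0) : ∃ G, x G ≠ 0 ∧ ∃ u ∈ G, G.erase u = F := by
  contrapose! h
  rw [partialBd, Finsupp.linearCombination_apply, Finsupp.sum, Finsupp.finsetSum_apply]
  refine Finset.sum_eq_zero fun G hG => ?_
  rw [Finsupp.smul_apply, Finsupp.finsetSum_apply, Finset.sum_eq_zero, smul_zero]
  intro u hu
  rw [Finsupp.smul_apply, Finsupp.single_eq_of_ne, smul_zero]
  exact (h G (Finsupp.mem_support_iff.1 hG) u (Finset.mem_inter.1 hu).1).symm

/-- If, in the cardinalities `k`, `k + 1`, `k + 2`, the boundary in `Δ` only sees the sets between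
`N \ A` and `N` having at least `k + 1` elements, then the homology in the corresponding degree has
a basis given by those sets of cardinality `k + 1` containing a fixed vertex `v ∈ A`. -/
lemma rhd0_eq_card_of_truncated {Δ : Set (Finset ℕ)} {k v : ℕ} {A N : Finset ℕ}
    (hAN : A ⊆ N) (hv : v ∈ A) (hlow : ∀ F ∈ Δ, F.card ≠ k)
    (hmid : ∀ F : Finset ℕ, F.card = k + 1 → (F ∈ Δ ↔ N \ A ⊆ F ∧ F ⊆ N))
    (hsub : ∀ F ∈ Δ, F ⊆ N)
    (hhigh : ∀ F : Finset ℕ, F.card = k + 2 → N \ A ⊆ F → F ⊆ N → F ∈ Δ) :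
    rhd0 K Δ (k + 1) =
      ((Finset.powersetCard (k + 1) N).filter fun F => N \ A ⊆ F ∧ v ∈ F).card := by
  have hbd : ∀ F ∈ Δ, F.card = k + 1 + 1 → ∀ u ∈ F, F.erase u ∈ Δ → u ∈ A := by
    intro F hF hc u hu hFu
    by_contra huA
    have := ((hmid _ (by rw [Finset.card_erase_of_mem hu, hc]; rfl)).1 hFu).1
      (Finset.mem_sdiff.2 ⟨hsub F hF hu, huA⟩)
    exact Finset.notMem_erase u F this
  have hcyc : cycles K (lab Δ) (k + 1) = ⊤ := by
    rw [eq_top_iff]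
    intro z _
    change bd K (lab Δ) k z = 0
    ext q
    exact absurd (card_face q) (hlow _ (face_mem q))
  have hfin : Finite (ChainIdx (lab Δ) (k + 1)) :=
    Finite.of_injective (fun q => (⟨face q, Finset.mem_powerset.2 (hsub _ (face_mem q))⟩ :
      {F // F ∈ N.powerset})) fun q q' h => face_injective Δ _ (Subtype.ext_iff.1 h)
  set P := LinearMap.range (bd K (lab Δ) (k + 1)) with hP
  set V : Set (ChainIdx (lab Δ) (k + 1)) := {q | v ∈ face q} with hV
  have hdisj : Disjoint P (Finsupp.supported K K V) := by
    rw [Submodule.disjoint_def]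
    rintro _ ⟨z, rfl⟩ hy
    rw [Finsupp.mem_supported'] at hy
    set y := bd K (lab Δ) (k + 1) z
    set w := partialBd K A (chainIncl K Δ (k + 2) z) with hw
    have hcone : coneMap K v (chainIncl K Δ (k + 1) y) = 0 := by
      ext F
      rw [coneMap_apply]
      split_ifs with hvF
      · by_cases hF : F.erase v ∈ Δ ∧ (F.erase v).card = k + 1
        · have h1 := chainIncl_apply K y (ofFace hF.1 hF.2)
          rw [face_ofFace] at h1
          rw [h1, hy _ (by simp [hV]), mul_zero]
          rfl
        · rw [chainIncl_apply_eq_zero K _ hF, mul_zero]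
          rfl
      · rfl
    have hout : ∀ F, N \ A ⊆ F → (w - chainIncl K Δ (k + 1) y) F = 0 := by
      intro F hF
      rw [Finsupp.sub_apply]
      by_cases hF' : F ∈ Δ ∧ F.card = k + 1
      · have h1 := chainIncl_apply K y (ofFace hF'.1 hF'.2)
        have h2 := bd_apply K hbd z (ofFace hF'.1 hF'.2)
        rw [face_ofFace] at h1 h2
        rw [h1, hw, ← h2, sub_self]
      · rw [chainIncl_apply_eq_zero K _ hF', sub_zero]
        by_contra hne
        obtain ⟨G, hG, u, hu, rfl⟩ := exists_of_partialBd_ne_zero K hne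
        have hG' : G ∈ Δ ∧ G.card = k + 2 := by
          by_contra h
          exact hG (chainIncl_apply_eq_zero K z h)
        have hc : (G.erase u).card = k + 1 := by rw [Finset.card_erase_of_mem hu, hG'.2]; rfl
        exact hF' ⟨(hmid _ hc).2 ⟨hF, (Finset.erase_subset _ _).trans (hsub _ hG'.1)⟩, hc⟩
    have hhom := cone_homotopy K hv (chainIncl K Δ (k + 1) y)
    have hwy : partialBd K A (chainIncl K Δ (k + 1) y) =
        - partialBd K A (w - chainIncl K Δ (k + 1) y) := by
      rw [map_sub, hw, partialBd_partialBd, zero_sub, neg_neg]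
    rw [hcone, map_zero, zero_add, hwy] at hhom
    ext q
    rw [← chainIncl_apply K y q, ← hhom, coneMap_apply]
    split_ifs with hvq
    · rw [Finsupp.neg_apply, partialBd_apply_eq_zero K hout, neg_zero, mul_zero]
      · rfl
      · intro u hu
        refine Finset.mem_erase.2 ⟨?_, ((hmid _ (card_face q)).1 (face_mem q)).1 hu⟩
        rintro rfl
        exact (Finset.mem_sdiff.1 hu).2 hv
    · rfl
  have hcodisj : Codisjoint P (Finsupp.supported K K V) := by
    rw [codisjoint_iff_le_sup]
    intro y _
    induction y using Finsupp.induction_linear with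
    | zero => exact zero_mem _
    | add f g hf hg => exact add_mem (hf trivial) (hg trivial)
    | single q c =>
      by_cases hvq : v ∈ face q
      · exact Submodule.mem_sup_right (Finsupp.single_mem_supported K c hvq)
      · have hq := (hmid _ (card_face q)).1 (face_mem q)
        have hGc : (insert v (face q)).card = k + 2 := by
          rw [Finset.card_insert_of_notMem hvq, card_face q]
        have hG := hhigh _ hGc (hq.1.trans (Finset.subset_insert _ _))
          (Finset.insert_subset (hAN hv) hq.2)
        set p : ChainIdx (lab Δ) (k + 1 + 1) := ofFace hG hGc with hp
        set s : K := (-1 : K) ^ ((face p).filter (fun w => w ≤ v)).card with hs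
        have hmem : Finsupp.single q 1 - s • bdElt K (lab Δ) (k + 1) p ∈
            Finsupp.supported K K V := by
          rw [Finsupp.mem_supported']
          intro q' hq'
          have hq'v : v ∉ face q' := hq'
          rw [Finsupp.sub_apply, Finsupp.smul_apply, bdElt_apply, Finset.sum_eq_single v]
          · have he : (face p).erase v = face q := Finset.erase_insert hvq
            rw [he, Finsupp.single_apply, smul_eq_mul]
            by_cases hqq : q = q'
            · rw [if_pos hqq, if_pos (congrArg face hqq), ← hs, neg_one_pow_mul_self, sub_self]
            · rw [if_neg hqq, if_neg fun h => hqq (face_injective _ _ h), mul_zero, sub_self]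
          · intro u hu huv
            refine if_neg fun e => hq'v ?_
            rw [← e]
            exact Finset.mem_erase.2 ⟨huv.symm, Finset.mem_insert_self _ _⟩
          · intro h
            exact absurd (Finset.mem_insert_self _ _) h
        have hsplit : Finsupp.single q c = c • (s • bdElt K (lab Δ) (k + 1) p) +
            c • (Finsupp.single q 1 - s • bdElt K (lab Δ) (k + 1) p) := by
          rw [← smul_add, add_sub_cancel, Finsupp.smul_single, smul_eq_mul, mul_one]
        rw [hsplit, ← bd_single]
        rw [← bd_single] at hmem
        exact add_mem (Submodule.mem_sup_left (P.smul_mem _ (P.smul_mem _ ⟨_, rfl⟩)))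
          (Submodule.mem_sup_right (Submodule.smul_mem _ _ hmem))
  have hcard := Submodule.finrank_add_eq_of_isCompl ⟨hdisj, hcodisj⟩
  have hV : Module.finrank K (Finsupp.supported K K V) = Nat.card V := by
    have := Fintype.ofFinite V
    rw [(Finsupp.supportedEquivFinsupp V).finrank_eq, Module.finrank_finsupp_self,
      Nat.card_eq_fintype_card]
  rw [rhd0, rhd, hcyc, inf_top_eq, finrank_top, ← hP, ← hcard, Nat.add_sub_cancel_left, hV,
    Nat.card_coe_set_eq, ← Set.ncard_image_of_injective _ (face_injective _ _),
    ← Set.ncard_coe_finset]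
  congr 1
  ext F
  simp only [Set.mem_image, Finset.coe_filter, Finset.mem_powersetCard, Set.mem_ofPred_eq]
  constructor
  · rintro ⟨q, hq, rfl⟩
    have h := (hmid _ (card_face q)).1 (face_mem q)
    exact ⟨⟨h.2, card_face q⟩, h.1, hq⟩
  · rintro ⟨⟨hFN, hFc⟩, hAF, hvF⟩
    exact ⟨ofFace ((hmid F hFc).2 ⟨hAF, hFN⟩) hFc, hvF, rfl⟩

lemma card_filter_sdiff_subset {A N : Finset ℕ} {v i : ℕ} (hAN : A ⊆ N) (hv : v ∈ A)
    (hi : i ≤ N.card) :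
    ((Finset.powersetCard i N).filter fun F => N \ A ⊆ F ∧ v ∈ F).card =
      (A.card - 1).choose (N.card - i) := by
  rw [← Finset.card_erase_of_mem hv, ← Finset.card_powersetCard]
  refine Finset.card_bij' (fun F _ => N \ F) (fun F _ => N \ F) ?_ ?_ ?_ ?_
  · intro F hF
    simp only [Finset.mem_filter, Finset.mem_powersetCard] at hF ⊢
    obtain ⟨⟨hFN, hc⟩, hAF, hvF⟩ := hF
    refine ⟨fun u hu => ?_, by rw [Finset.card_sdiff_of_subset hFN, hc]⟩
    rw [Finset.mem_sdiff] at hu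
    rw [Finset.mem_erase]
    refine ⟨fun h => hu.2 (h ▸ hvF), ?_⟩
    by_contra huA
    exact hu.2 (hAF (Finset.mem_sdiff.2 ⟨hu.1, huA⟩))
  · intro F hF
    simp only [Finset.mem_filter, Finset.mem_powersetCard] at hF ⊢
    obtain ⟨hFA, hc⟩ := hF
    have hFA' : F ⊆ A := hFA.trans (Finset.erase_subset _ _)
    refine ⟨⟨Finset.sdiff_subset, ?_⟩, Finset.sdiff_subset_sdiff le_rfl hFA', ?_⟩
    · rw [Finset.card_sdiff_of_subset (hFA'.trans hAN), hc]
      omega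
    · exact Finset.mem_sdiff.2 ⟨hAN hv, fun h => Finset.notMem_erase v A (hFA h)⟩
  · intro F hF
    simp only [Finset.mem_filter, Finset.mem_powersetCard] at hF
    exact Finset.sdiff_sdiff_eq_self hF.1.1
  · intro F hF
    simp only [Finset.mem_powersetCard] at hF
    exact Finset.sdiff_sdiff_eq_self ((hF.1.trans (Finset.erase_subset _ _)).trans hAN)

end Restriction

/-! ## Monomials outside the ideals `Q_μ` -/

section Fits

variable {n : ℕ}

/-- The exponent vector `b` lies, after a permutation of its entries, below `μ`. -/
def Fits (b : Fin n → ℕ) (μ : Fin n → ℕ∞) : Prop :=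
  ∃ σ : Equiv.Perm (Fin n), ∀ i, (b (σ i) : ℕ∞) ≤ μ i

lemma not_le_iff_toNat_lt {m : ℕ} {x : ℕ∞} : ¬ (m : ℕ∞) ≤ x ↔ x ≠ ⊤ ∧ x.toNat + 1 ≤ m := by
  cases x with
  | top => simp
  | coe x => simp

lemma mon_mem_map_rename_iff (K : Type) [Field K] (μ : Fin n → ℕ∞) (σ : Equiv.Perm (Fin n))
    (b : Fin n → ℕ) :
    mon K n b ∈ Ideal.map (MvPolynomial.rename σ).toRingHom
      (Ideal.span {g : MvPolynomial (Fin n) K |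
        ∃ i : Fin n, μ i ≠ ⊤ ∧ g = MvPolynomial.X i ^ ((μ i).toNat + 1)}) ↔
      ∃ i, ¬ (b (σ i) : ℕ∞) ≤ μ i := by
  have hX : ∀ i m, (MvPolynomial.rename σ).toRingHom (MvPolynomial.X i ^ m) =
      MvPolynomial.monomial (Finsupp.single (σ i) m) (1 : K) := by
    intro i m
    rw [MvPolynomial.X_pow_eq_monomial]
    exact (MvPolynomial.rename_monomial _ _ _).trans (by rw [Finsupp.mapDomain_single])
  have himg : (MvPolynomial.rename σ).toRingHom '' {g : MvPolynomial (Fin n) K |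
        ∃ i : Fin n, μ i ≠ ⊤ ∧ g = MvPolynomial.X i ^ ((μ i).toNat + 1)} =
      (fun s => MvPolynomial.monomial s (1 : K)) ''
        {s | ∃ i : Fin n, μ i ≠ ⊤ ∧ s = Finsupp.single (σ i) ((μ i).toNat + 1)} := by
    ext g
    constructor
    · rintro ⟨_, ⟨i, hi, rfl⟩, rfl⟩
      exact ⟨_, ⟨i, hi, rfl⟩, (hX i _).symm⟩
    · rintro ⟨_, ⟨i, hi, rfl⟩, rfl⟩
      exact ⟨_, ⟨i, hi, rfl⟩, hX i _⟩
  rw [Ideal.map_span, himg, MvPolynomial.mem_ideal_span_monomial_image, mon,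
    MvPolynomial.support_monomial, if_neg one_ne_zero]
  simp only [Finset.mem_singleton, forall_eq, not_le_iff_toNat_lt]
  constructor
  · rintro ⟨_, ⟨i, hi, rfl⟩, h⟩
    exact ⟨i, hi, by simpa using h (σ i)⟩
  · rintro ⟨i, hi, h⟩
    refine ⟨_, ⟨i, hi, rfl⟩, fun j => ?_⟩
    rw [Finsupp.single_apply]
    split_ifs with hj
    · simpa [← hj] using h
    · exact Nat.zero_le _

lemma mon_mem_Qgen_iff (K : Type) [Field K] (μ : Fin n → ℕ∞) (b : Fin n → ℕ) :
    mon K n b ∈ Qgen K n μ ↔ ¬ Fits b μ := by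
  rw [Qgen, Ideal.mem_iInf]
  simp only [mon_mem_map_rename_iff, Fits, not_exists, not_forall]

lemma mon_notMem_iff {K : Type} [Field K] {I : Ideal (MvPolynomial (Fin n) K)}
    {Λ : Finset (Fin n → ℕ∞)} (hpres : IsDualPresentation K n I Λ) (b : Fin n → ℕ) :
    mon K n b ∉ I ↔ ∃ μ ∈ Λ, Fits b μ := by
  rw [hpres.2.1]
  simp only [Ideal.mem_iInf, mon_mem_Qgen_iff, not_forall, not_not, exists_prop]

lemma Qgen_anti (K : Type) [Field K] {μ ρ : Fin n → ℕ∞} (h : ρ ≤ μ) :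
    Qgen K n μ ≤ Qgen K n ρ := by
  refine iInf_mono fun σ => Ideal.map_mono (Ideal.span_le.2 ?_)
  rintro _ ⟨i, hi, rfl⟩
  have hρ : ρ i ≠ ⊤ := fun e => hi (top_le_iff.1 (e ▸ h i))
  exact Ideal.mem_of_dvd _ (pow_dvd_pow _ (Nat.add_le_add_right (ENat.toNat_le_toNat (h i) hi) 1))
    (Ideal.subset_span ⟨i, hρ, rfl⟩)

lemma eq_of_le_of_isDualPresentation {K : Type} [Field K] {I : Ideal (MvPolynomial (Fin n) K)}
    {Λ : Finset (Fin n → ℕ∞)} (hpres : IsDualPresentation K n I Λ) {μ ρ : Fin n → ℕ∞}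
    (hρ : ρ ∈ Λ) (hμ : μ ∈ Λ) (h : ρ ≤ μ) : ρ = μ := by
  by_contra hne
  refine hpres.2.2 ρ hρ ?_
  conv_lhs => rw [hpres.2.1]
  refine le_antisymm (le_iInf₂ fun ν hν => le_iInf fun _ => iInf₂_le ν hν) ?_
  refine le_iInf₂ fun ν hν => ?_
  by_cases hνρ : ν = ρ
  · subst hνρ
    exact (iInf₂_le_of_le μ hμ (iInf_le _ (Ne.symm hne))).trans (Qgen_anti K h)
  · exact iInf₂_le_of_le ν hν (iInf_le _ hνρ)

lemma exists_ne_top_of_mem {K : Type} [Field K] {I : Ideal (MvPolynomial (Fin n) K)}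
    (hne : I ≠ ⊥) {Λ : Finset (Fin n → ℕ∞)} (hpres : IsDualPresentation K n I Λ)
    {ρ : Fin n → ℕ∞} (hρ : ρ ∈ Λ) : ∃ i, ρ i ≠ ⊤ := by
  by_contra! h
  refine hne (le_bot_iff.1 ?_)
  rw [hpres.2.1]
  refine (iInf₂_le ρ hρ).trans ((iInf_le _ 1).trans ?_)
  simp [h]

/-- Comparing a rearrangement of an antitone vector with an antitone vector. -/
lemma le_of_comp_perm_le {α : Type*} [Preorder α] {f g : Fin n → α} (hf : Antitone f)
    (hg : Antitone g) (σ : Equiv.Perm (Fin n)) (h : ∀ i, f (σ i) ≤ g i) (t : Fin n) :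
    f t ≤ g t := by
  obtain ⟨s, hts, hs⟩ : ∃ s, t ≤ s ∧ σ s ≤ t := by
    by_contra! hcon
    have hsub : (Finset.Iic t).map σ.symm.toEmbedding ⊆ Finset.Iio t := by
      intro s hs
      rw [Finset.mem_map_equiv, Equiv.symm_symm, Finset.mem_Iic] at hs
      rw [Finset.mem_Iio]
      by_contra hst
      exact absurd hs (hcon s (not_lt.1 hst)).not_ge
    have := Finset.card_le_card hsub
    rw [Finset.card_map, Fin.card_Iic, Fin.card_Iio] at this
    omega
  exact (hf hs).trans ((h s).trans (hg hts))

lemma toNat_le_topVal (μ : Fin n → ℕ∞) (i : Fin n) : (μ i).toNat ≤ topVal n μ :=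
  Finset.le_sup (f := fun i => (μ i).toNat) (Finset.mem_univ i)

lemma tildeOf_le (μ : Fin n → ℕ∞) (i : Fin n) : tildeOf n μ i ≤ topVal n μ + 1 := by
  have := toNat_le_topVal μ i
  unfold tildeOf
  split_ifs <;> omega

lemma one_le_tildeOf (μ : Fin n → ℕ∞) (i : Fin n) : 1 ≤ tildeOf n μ i := by
  unfold tildeOf
  split_ifs <;> omega

lemma tildeOf_of_eq_top {μ : Fin n → ℕ∞} {i : Fin n} (h : μ i = ⊤) :
    tildeOf n μ i = topVal n μ + 1 := if_pos h

lemma coe_tildeOf_of_ne_top {μ : Fin n → ℕ∞} {i : Fin n} (h : μ i ≠ ⊤) :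
    (tildeOf n μ i : ℕ∞) = μ i + 1 := by
  rw [tildeOf, if_neg h]
  push_cast
  rw [ENat.natCast_toNat h]

lemma tildeOf_antitone {μ : Fin n → ℕ∞} (h : Antitone μ) : Antitone (tildeOf n μ) := by
  intro i j hij
  by_cases hi : μ i = ⊤
  · rw [tildeOf_of_eq_top hi]
    exact tildeOf_le μ j
  · have hj : μ j ≠ ⊤ := fun e => hi (top_le_iff.1 (e ▸ h hij))
    rw [tildeOf, tildeOf, if_neg hi, if_neg hj]
    exact Nat.add_le_add_right (ENat.toNat_le_toNat (h hij) hi) 1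

lemma exists_toNat_eq_topVal {μ : Fin n → ℕ∞} (h : ∃ i, μ i ≠ ⊤) :
    ∃ i, μ i ≠ ⊤ ∧ (μ i).toNat = topVal n μ := by
  obtain ⟨j, hj⟩ := h
  obtain ⟨i, -, hi⟩ := Finset.exists_mem_eq_sup Finset.univ ⟨j, Finset.mem_univ j⟩
    fun i => (μ i).toNat
  by_cases hit : μ i = ⊤
  · refine ⟨j, hj, le_antisymm (toNat_le_topVal μ j) ?_⟩
    rw [topVal, hi, hit]
    exact Nat.zero_le _
  · exact ⟨i, hit, hi.symm⟩

lemma ellInf_lt {μ : Fin n → ℕ∞} (h : ∃ i, μ i ≠ ⊤) : ellInf n μ < n := by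
  obtain ⟨i, hi⟩ := h
  have := Finset.card_lt_card (Finset.filter_ssubset.2 ⟨i, Finset.mem_univ i, hi⟩ :
    (Finset.univ.filter fun i => μ i = ⊤) ⊂ Finset.univ)
  simpa [ellInf] using this

end Fits

/-! ## Homology of the Koszul strands -/

section Strands

variable {n : ℕ}

lemma sum_eF {F : Finset ℕ} (hF : F ⊆ Finset.range n) : ∑ i : Fin n, eF F i = F.card := by
  rw [Fin.sum_univ_eq_sum_range (fun j => eF F j) n]
  simp only [eF]
  rw [Finset.sum_ite_mem, Finset.inter_eq_right.2 hF, Finset.card_eq_sum_ones]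

lemma ellInf_eq_sum (μ : Fin n → ℕ∞) : ellInf n μ = ∑ i, if μ i = ⊤ then 1 else 0 :=
  Finset.card_filter _ _

lemma mem_KosQ_iff {K : Type} [Field K] {I : Ideal (MvPolynomial (Fin n) K)}
    {Λ : Finset (Fin n → ℕ∞)} (hpres : IsDualPresentation K n I Λ) (a : Fin n → ℕ)
    (F : Finset ℕ) :
    F ∈ KosQ K n I a ↔ F ⊆ Finset.range n ∧ (∀ i : Fin n, (i : ℕ) ∈ F → 1 ≤ a i) ∧
      ∃ μ ∈ Λ, Fits (fun i => a i - eF F i) μ := by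
  rw [← mon_notMem_iff hpres]
  rfl

/-- If `a` is bounded by `topVal μ + 1` and `a - e_F` fits below `μ`, then `a` is entrywise at
most `μ̃`, with a gain of one at the finite entries of `μ` that meet no element of `F`. -/
lemma apply_perm_le {μ : Fin n → ℕ∞} {a : Fin n → ℕ} {F : Finset ℕ} {σ : Equiv.Perm (Fin n)}
    (hσ : ∀ j, ((a (σ j) - eF F (σ j) : ℕ) : ℕ∞) ≤ μ j) (ha : ∀ i, a i ≤ topVal n μ + 1)
    (j : Fin n) : a (σ j) ≤ tildeOf n μ j ∧
      a (σ j) + 1 ≤ tildeOf n μ j + (if μ j = ⊤ then 1 else 0) + eF F (σ j) := by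
  have hj := hσ j
  by_cases h : μ j = ⊤
  · rw [tildeOf_of_eq_top h, if_pos h]
    have := ha (σ j)
    omega
  · have h1 : a (σ j) - eF F (σ j) ≤ (μ j).toNat := by
      rw [← ENat.natCast_toNat h] at hj
      exact_mod_cast hj
    have h2 : eF F (σ j) ≤ 1 := by unfold eF; split_ifs <;> omega
    rw [tildeOf, if_neg h, if_neg h]
    omega

lemma sum_add_le {μ : Fin n → ℕ∞} {a : Fin n → ℕ} {F : Finset ℕ} {σ : Equiv.Perm (Fin n)}
    (hF : F ⊆ Finset.range n)
    (hσ : ∀ j, ((a (σ j) - eF F (σ j) : ℕ) : ℕ∞) ≤ μ j) (ha : ∀ i, a i ≤ topVal n μ + 1) :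
    ∑ i, a i + n ≤ ∑ i, tildeOf n μ i + ellInf n μ + F.card := by
  have h := Finset.sum_le_sum fun j (_ : j ∈ Finset.univ) => (apply_perm_le hσ ha j).2
  rw [Finset.sum_add_distrib, Finset.sum_add_distrib, Finset.sum_add_distrib,
    Equiv.sum_comp σ a, Equiv.sum_comp σ (fun i => eF F i), sum_eF hF, ← ellInf_eq_sum] at h
  simpa using h

lemma fits_erase {μ : Fin n → ℕ∞} {a : Fin n → ℕ} {F : Finset ℕ} {v : Fin n}
    (hF : F ⊆ Finset.range n) (hv : ∀ i, a i ≤ a v) (h : Fits (fun i => a i - eF F i) μ)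
    (hell : ∀ σ : Equiv.Perm (Fin n), (∀ j, ((a (σ j) - eF F (σ j) : ℕ) : ℕ∞) ≤ μ j) →
      (∀ i, a i ≤ topVal n μ + 1) → n < F.card + ellInf n μ) :
    Fits (fun i => a i - eF (F.erase v) i) μ := by
  obtain ⟨σ, hσ⟩ := h
  have hne : ∀ i, i ≠ v → eF (F.erase v) i = eF F i := by
    intro i hi
    have : (i : ℕ) ≠ v := fun e => hi (Fin.ext e)
    simp [eF, this]
  by_cases hvF : (v : ℕ) ∈ F
  swap
  · rw [Finset.erase_eq_of_notMem hvF]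
    exact ⟨σ, hσ⟩
  obtain ⟨j₀, hj₀⟩ := σ.surjective v
  by_cases hinf : μ j₀ = ⊤
  · refine ⟨σ, fun j => ?_⟩
    by_cases hj : j = j₀
    · simp [hj, hinf]
    · have hjv : σ j ≠ v := fun e => hj (σ.injective (e.trans hj₀.symm))
      simpa only [hne _ hjv] using hσ j
  have hvle : a v - 1 ≤ (μ j₀).toNat := by
    have h0 : ((a (σ j₀) - eF F (σ j₀) : ℕ) : ℕ∞) ≤ μ j₀ := hσ j₀
    rw [hj₀, ← ENat.natCast_toNat hinf, eF, if_pos hvF] at h0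
    exact_mod_cast h0
  have hbound : ∀ i, a i ≤ topVal n μ + 1 := by
    intro i
    have := toNat_le_topVal μ j₀
    have := hv i
    omega
  have hlt := hell σ hσ hbound
  obtain ⟨j₁, hj₁, hj₁F⟩ : ∃ j, μ j = ⊤ ∧ (σ j : ℕ) ∈ F := by
    by_contra! hcon
    have hle : ∑ j, (eF F (σ j) + if μ j = ⊤ then 1 else 0) ≤ ∑ _j : Fin n, 1 := by
      refine Finset.sum_le_sum fun j _ => ?_
      unfold eF
      by_cases hj : μ j = ⊤
      · simp [hj, hcon j hj]
      · simp only [hj, if_false]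
        split_ifs <;> omega
    rw [Finset.sum_add_distrib, Equiv.sum_comp σ (fun i => eF F i), sum_eF hF,
      ← ellInf_eq_sum] at hle
    simp at hle
    omega
  have hj₁₀ : j₁ ≠ j₀ := fun e => hinf (e ▸ hj₁)
  refine ⟨(Equiv.swap j₀ j₁).trans σ, fun j => ?_⟩
  rw [Equiv.trans_apply]
  by_cases h1 : j = j₁
  · simp [h1, hj₁]
  by_cases h0 : j = j₀
  · have hne' : σ j₁ ≠ v := fun e => hj₁₀ (σ.injective (e.trans hj₀.symm))
    beta_reduce
    rw [h0, Equiv.swap_apply_left, hne _ hne', eF, if_pos hj₁F, ← ENat.natCast_toNat hinf]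
    have := hv (σ j₁)
    exact_mod_cast (by omega : a (σ j₁) - 1 ≤ (μ j₀).toNat)
  · have hjv : σ j ≠ v := fun e => h0 (σ.injective (e.trans hj₀.symm))
    beta_reduce
    rw [Equiv.swap_apply_of_ne_of_ne h0 h1, hne _ hjv]
    exact hσ j

/-- Every nonzero component of `Tor` is dominated by a dual generator. -/
lemma exists_dualGenerator_of_torQDim_ne_zero {K : Type} [Field K]
    {I : Ideal (MvPolynomial (Fin n) K)} {Λ : Finset (Fin n → ℕ∞)}
    (hpres : IsDualPresentation K n I Λ) {i : ℕ} (hi : 1 ≤ i) {l : Fin n → ℕ} (hl : Antitone l)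
    (π : Equiv.Perm (Fin n)) (h : torQDim K n I i (l ∘ π) ≠ 0) :
    ∃ ρ ∈ Λ, (∀ t, l t ≤ tildeOf n ρ t) ∧ i + ellInf n ρ ≤ n ∧
      ∑ t, l t + n ≤ ∑ t, tildeOf n ρ t + ellInf n ρ + i := by
  by_contra! hno
  refine h ?_
  obtain ⟨k, rfl⟩ : ∃ k, i = k + 1 := ⟨i - 1, by omega⟩
  set a : Fin n → ℕ := l ∘ π with ha
  have hsub : ∀ F ∈ KosQ K n I a, F ⊆ Finset.range (n + 1) := fun F hF =>
    hF.1.trans (Finset.range_subset_range.2 (Nat.le_succ n))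
  by_cases hex : ∃ F ∈ KosQ K n I a, F.card = k + 1
  swap
  · push Not at hex
    exact rhd0_eq_zero_of_cone K (v := 0) hsub (by simp) (fun F hF hc => absurd hc (hex F hF))
      fun F hF hc => absurd hc (hex F hF)
  obtain ⟨F₀, hF₀, hc₀⟩ := hex
  obtain ⟨u, hu⟩ := Finset.card_pos.1 (by omega : 0 < F₀.card)
  have hun : u < n := Finset.mem_range.1 (hF₀.1 hu)
  obtain ⟨v, -, hv⟩ := Finset.exists_max_image Finset.univ a ⟨⟨u, hun⟩, Finset.mem_univ _⟩
  have hv' : ∀ i, a i ≤ a v := fun i => hv i (Finset.mem_univ i)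
  have hav : 1 ≤ a v := (hF₀.2.1 ⟨u, hun⟩ hu).trans (hv' _)
  refine rhd0_eq_zero_of_cone K (v := v) hsub (Finset.mem_range.2 (by omega)) ?_ ?_
  · intro F hF hc
    rw [mem_KosQ_iff hpres] at hF ⊢
    obtain ⟨hFn, hpos, μ, hμ, hfit⟩ := hF
    refine ⟨(Finset.erase_subset _ _).trans hFn,
      fun i hi => hpos i (Finset.mem_of_mem_erase hi), μ, hμ,
      fits_erase hFn hv' hfit fun σ hσ hb => ?_⟩
    by_contra hlt
    have hanti : ∀ t, l t ≤ tildeOf n μ t :=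
      le_of_comp_perm_le hl (tildeOf_antitone (hpres.1 μ hμ)) (σ.trans π)
        fun j => (apply_perm_le hσ hb j).1
    have hsum := sum_add_le hFn hσ hb
    rw [ha, Function.comp_def, Equiv.sum_comp π l, hc] at hsum
    exact absurd hsum (hno μ hμ hanti (by omega)).not_ge
  · intro F hF hc
    rw [mem_KosQ_iff hpres] at hF ⊢
    obtain ⟨hFn, hpos, μ, hμ, σ, hσ⟩ := hF
    refine ⟨Finset.insert_subset (Finset.mem_range.2 v.2) hFn, fun i hi => ?_, μ, hμ, σ,
      fun j => le_trans ?_ (hσ j)⟩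
    · rcases Finset.mem_insert.1 hi with h | h
      · rwa [Fin.ext h]
      · exact hpos i h
    · have : eF F (σ j) ≤ eF (insert (v : ℕ) F) (σ j) := by
        unfold eF
        by_cases h : (σ j : ℕ) ∈ F
        · simp [h]
        · simp [h]
      exact_mod_cast Nat.sub_le_sub_left this _

/-- A finset can be moved into another one, at least as large, by a permutation supported on any
finset containing both. -/
lemma exists_perm_maps_into {α : Type*} [DecidableEq α] {A P : Finset α} (hP : P ⊆ A)
    (C : Finset α) (hC : C ⊆ A) (hcard : C.card ≤ P.card) :
    ∃ τ : Equiv.Perm α, (∀ x ∈ C, τ x ∈ P) ∧ ∀ x, x ∉ A → τ x = x := by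
  induction hm : (C \ P).card using Nat.strong_induction_on generalizing C with
  | _ m ih =>
    by_cases hCP : C ⊆ P
    · exact ⟨1, fun x hx => hCP hx, fun _ _ => rfl⟩
    obtain ⟨x, hxC, hxP⟩ := Finset.not_subset.1 hCP
    obtain ⟨y, hyP, hyC⟩ : ∃ y ∈ P, y ∉ C := by
      by_contra! hPC
      exact hCP (Finset.eq_of_subset_of_card_le hPC hcard).ge
    have hss : (C.map (Equiv.swap x y).toEmbedding) \ P ⊂ C \ P := by
      rw [Finset.ssubset_iff_of_subset]
      · refine ⟨x, Finset.mem_sdiff.2 ⟨hxC, hxP⟩, fun h => hyC ?_⟩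
        have := (Finset.mem_sdiff.1 h).1
        rwa [Finset.mem_map_equiv, Equiv.symm_swap, Equiv.swap_apply_left] at this
      · intro z hz
        rw [Finset.mem_sdiff, Finset.mem_map_equiv, Equiv.symm_swap] at hz
        have hzy : z ≠ y := fun e => hz.2 (e ▸ hyP)
        have hzx : z ≠ x := by
          rintro rfl
          rw [Equiv.swap_apply_left] at hz
          exact hyC hz.1
        rw [Equiv.swap_apply_of_ne_of_ne hzx hzy] at hz
        exact Finset.mem_sdiff.2 hz
    obtain ⟨τ, hτ, hτA⟩ := ih _ (hm ▸ Finset.card_lt_card hss) (C.map (Equiv.swap x y).toEmbedding)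
      (by
        intro z hz
        rw [Finset.mem_map_equiv, Equiv.symm_swap] at hz
        by_cases hzy : z = y
        · exact hzy ▸ hP hyP
        by_cases hzx : z = x
        · exact hzx ▸ hC hxC
        · rw [Equiv.swap_apply_of_ne_of_ne hzx hzy] at hz
          exact hC hz) (by rwa [Finset.card_map]) rfl
    refine ⟨(Equiv.swap x y).trans τ, fun z hz => hτ _ ?_, fun z hz => ?_⟩
    · exact Finset.mem_map_of_mem (Equiv.swap x y).toEmbedding hz
    · rw [Equiv.trans_apply, Equiv.swap_apply_of_ne_of_ne, hτA z hz]
      · exact fun e => hz (e ▸ hC hxC)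
      · exact fun e => hz (e ▸ hP hyP)

end Strands

/-! ## The homology attached to a maximal dual generator -/

section Maximal

variable {n : ℕ} {K : Type} [Field K] {I : Ideal (MvPolynomial (Fin n) K)}
  {Λ : Finset (Fin n → ℕ∞)}

/-- In the multidegree `ρ̃` of a maximal dual generator `ρ`, a small face of the Koszul complex
comes from `ρ` itself. -/
lemma fits_of_mem_KosQ_of_maximal (hpres : IsDualPresentation K n I Λ) {ρ : Fin n → ℕ∞}
    (hρ : ρ ∈ Λ) (hmax : ∀ μ ∈ Λ, preceq n ρ μ → μ = ρ) {F : Finset ℕ}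
    (hF : F ∈ KosQ K n I (tildeOf n ρ)) (hcard : F.card + ellInf n ρ ≤ n) :
    Fits (fun i => tildeOf n ρ i - eF F i) ρ := by
  rw [mem_KosQ_iff hpres] at hF
  obtain ⟨hFn, -, μ, hμ, σ, hσ⟩ := hF
  suffices h : μ = ρ from ⟨σ, h ▸ hσ⟩
  have hρa := hpres.1 ρ hρ
  have hμa := hpres.1 μ hμ
  by_cases htop : topVal n ρ ≤ topVal n μ
  · have hb : ∀ i, tildeOf n ρ i ≤ topVal n μ + 1 := fun i => (tildeOf_le ρ i).trans (by omega)
    have hle : ∀ t, tildeOf n ρ t ≤ tildeOf n μ t :=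
      le_of_comp_perm_le (tildeOf_antitone hρa) (tildeOf_antitone hμa) σ
        fun j => (apply_perm_le hσ hb j).1
    have hsum := sum_add_le hFn hσ hb
    exact hmax μ hμ ⟨hle, by omega⟩
  · refine (eq_of_le_of_isDualPresentation hpres hρ hμ fun j => ?_).symm
    have hle : (tildeOf n ρ j : ℕ∞) ≤ μ j + 1 := by
      refine le_of_comp_perm_le (f := fun j => (tildeOf n ρ j : ℕ∞)) (g := fun j => μ j + 1)
        (fun _ _ h => Nat.cast_le.2 (tildeOf_antitone hρa h))
        (fun _ _ h => add_le_add_left (hμa h) 1) σ (fun i => ?_) j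
      have h2 : tildeOf n ρ (σ i) ≤ (tildeOf n ρ (σ i) - eF F (σ i)) + 1 := by
        unfold eF
        split_ifs <;> omega
      calc (tildeOf n ρ (σ i) : ℕ∞) ≤ ((tildeOf n ρ (σ i) - eF F (σ i) + 1 : ℕ) : ℕ∞) := by
            exact_mod_cast h2
        _ ≤ μ i + 1 := by
            push_cast
            exact add_le_add_left (by exact_mod_cast hσ i) 1
    by_cases hμj : μ j = ⊤
    · rw [hμj]
      exact le_top
    by_cases hρj : ρ j = ⊤
    · rw [tildeOf_of_eq_top hρj, ← ENat.natCast_toNat hμj] at hle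
      have h1 : topVal n ρ + 1 ≤ (μ j).toNat + 1 := by exact_mod_cast hle
      have := toNat_le_topVal μ j
      omega
    · rw [coe_tildeOf_of_ne_top hρj] at hle
      exact (ENat.add_le_add_iff_right ENat.one_ne_top).1 hle

/-- A face supporting `ρ̃ - e_F ≤ ρ` up to permutation contains all the positions at which `ρ̃`
is not maximal. -/
lemma subset_of_fits {ρ : Fin n → ℕ∞} {F : Finset ℕ}
    (hF : F ⊆ Finset.range n) (h : Fits (fun i => tildeOf n ρ i - eF F i) ρ) :
    n ≤ F.card + ellInf n ρ ∧
      ∀ x : Fin n, tildeOf n ρ x ≠ topVal n ρ + 1 → (x : ℕ) ∈ F := by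
  obtain ⟨σ, hσ⟩ := h
  have hle := apply_perm_le hσ (tildeOf_le ρ)
  have hsum := sum_add_le hF hσ (tildeOf_le ρ)
  refine ⟨by omega, fun x hx => ?_⟩
  have heq : ∀ j, tildeOf n ρ (σ j) = tildeOf n ρ j := by
    have := (Finset.sum_eq_sum_iff_of_le fun j (_ : j ∈ Finset.univ) => (hle j).1).1
      (Equiv.sum_comp σ (tildeOf n ρ))
    exact fun j => this j (Finset.mem_univ j)
  obtain ⟨j, rfl⟩ := σ.surjective x
  have hj : ρ j ≠ ⊤ := fun e => hx ((heq j).trans (tildeOf_of_eq_top e))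
  by_contra hjF
  have := (hle j).2
  rw [heq j, if_neg hj, eF, if_neg hjF] at this
  omega

lemma fits_of_subset {ρ : Fin n → ℕ∞} {F : Finset ℕ} (hF : F ⊆ Finset.range n)
    (hcard : n ≤ F.card + ellInf n ρ)
    (hsub : ∀ x : Fin n, tildeOf n ρ x ≠ topVal n ρ + 1 → (x : ℕ) ∈ F) :
    Fits (fun i => tildeOf n ρ i - eF F i) ρ := by
  have hcardC : (Finset.univ.filter fun i : Fin n => (i : ℕ) ∉ F).card + F.card = n := by
    have h1 := Finset.card_filter_add_card_filter_not (s := (Finset.univ : Finset (Fin n)))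
      fun i => (i : ℕ) ∈ F
    have h2 : (Finset.univ.filter fun i : Fin n => (i : ℕ) ∈ F).card = F.card := by
      rw [← sum_eF hF, Finset.card_filter]
      rfl
    rw [Finset.card_univ, Fintype.card_fin] at h1
    omega
  obtain ⟨τ, hτ, hτA⟩ := exists_perm_maps_into
    (A := Finset.univ.filter fun i => tildeOf n ρ i = topVal n ρ + 1)
    (P := Finset.univ.filter fun i => ρ i = ⊤)
    (fun i hi => Finset.mem_filter.2
      ⟨Finset.mem_univ i, tildeOf_of_eq_top (Finset.mem_filter.1 hi).2⟩)
    (Finset.univ.filter fun i : Fin n => (i : ℕ) ∉ F)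
    (fun i hi => Finset.mem_filter.2 ⟨Finset.mem_univ i, by
      by_contra hcon
      exact (Finset.mem_filter.1 hi).2 (hsub i hcon)⟩)
    (by
      change _ ≤ ellInf n ρ
      omega)
  refine ⟨τ.symm, fun j => ?_⟩
  obtain ⟨x, rfl⟩ := τ.surjective j
  beta_reduce
  rw [Equiv.symm_apply_apply]
  by_cases hxtop : ρ (τ x) = ⊤
  · rw [hxtop]
    exact le_top
  have hxF : (x : ℕ) ∈ F := by
    by_contra hcon
    exact hxtop (Finset.mem_filter.1 (hτ x (Finset.mem_filter.2 ⟨Finset.mem_univ x, hcon⟩))).2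
  have hle : tildeOf n ρ x ≤ tildeOf n ρ (τ x) := by
    by_cases hxA : x ∈ Finset.univ.filter fun i => tildeOf n ρ i = topVal n ρ + 1
    · have hτx : τ x ∈ Finset.univ.filter fun i => tildeOf n ρ i = topVal n ρ + 1 := by
        by_contra hcon
        exact hcon ((τ.injective (hτA _ hcon)).symm ▸ hxA)
      rw [(Finset.mem_filter.1 hxA).2, (Finset.mem_filter.1 hτx).2]
    · rw [hτA x hxA]
  rw [tildeOf, tildeOf, if_neg hxtop] at hle
  rw [eF, if_pos hxF, ← ENat.natCast_toNat hxtop]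
  exact_mod_cast (by rw [tildeOf]; omega : tildeOf n ρ x - 1 ≤ (ρ (τ x)).toNat)

lemma ellInf_lt_card {ρ : Fin n → ℕ∞} (h : ∃ i, ρ i ≠ ⊤) :
    ellInf n ρ < (Finset.univ.filter fun i => tildeOf n ρ i = topVal n ρ + 1).card := by
  obtain ⟨i, hi, hitop⟩ := exists_toNat_eq_topVal h
  refine Finset.card_lt_card ((Finset.ssubset_iff_of_subset fun j hj => ?_).2 ⟨i, ?_, ?_⟩)
  · exact Finset.mem_filter.2 ⟨Finset.mem_univ j, tildeOf_of_eq_top (Finset.mem_filter.1 hj).2⟩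
  · exact Finset.mem_filter.2 ⟨Finset.mem_univ i, by rw [tildeOf, if_neg hi, hitop]⟩
  · exact fun hcon => hi (Finset.mem_filter.1 hcon).2

/-- The Betti number of `R/I` attached to a maximal dual generator. -/
lemma torQDim_tildeOf_of_maximal (hne : I ≠ ⊥) (hpres : IsDualPresentation K n I Λ)
    {ρ : Fin n → ℕ∞} (hρ : ρ ∈ Λ) (hmax : ∀ μ ∈ Λ, preceq n ρ μ → μ = ρ) :
    torQDim K n I (n - ellInf n ρ) (tildeOf n ρ) =
      ((Finset.univ.filter fun i => tildeOf n ρ i = topVal n ρ + 1).card - 1).choose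
        (ellInf n ρ) := by
  have hfin := exists_ne_top_of_mem hne hpres hρ
  have hlt := ellInf_lt hfin
  obtain ⟨k, hk⟩ : ∃ k, n - ellInf n ρ = k + 1 := ⟨n - ellInf n ρ - 1, by omega⟩
  obtain ⟨v, hv, hvtop⟩ := exists_toNat_eq_topVal hfin
  set B := Finset.univ.filter fun i => tildeOf n ρ i = topVal n ρ + 1 with hB
  have hmem : ∀ x : Fin n, (x : ℕ) ∈ B.map Fin.valEmbedding ↔
      tildeOf n ρ x = topVal n ρ + 1 := fun x => by simp [hB, Fin.val_inj]
  have hAN : B.map Fin.valEmbedding ⊆ Finset.range n := by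
    intro x hx
    obtain ⟨y, -, rfl⟩ := Finset.mem_map.1 hx
    exact Finset.mem_range.2 y.2
  have hvA : (v : ℕ) ∈ B.map Fin.valEmbedding :=
    (hmem v).2 (by rw [tildeOf, if_neg hv, hvtop])
  have hsdiff : ∀ F : Finset ℕ, Finset.range n \ B.map Fin.valEmbedding ⊆ F ↔
      ∀ x : Fin n, tildeOf n ρ x ≠ topVal n ρ + 1 → (x : ℕ) ∈ F := by
    intro F
    constructor
    · exact fun h x hx => h (Finset.mem_sdiff.2 ⟨Finset.mem_range.2 x.2, fun e =>
        hx ((hmem x).1 e)⟩)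
    · intro h x hx
      obtain ⟨hxn, hxA⟩ := Finset.mem_sdiff.1 hx
      exact h ⟨x, Finset.mem_range.1 hxn⟩ fun e => hxA ((hmem ⟨x, _⟩).2 e)
  have hfits : ∀ F : Finset ℕ, F ⊆ Finset.range n → Fits (fun i => tildeOf n ρ i - eF F i) ρ →
      F ∈ KosQ K n I (tildeOf n ρ) := fun F hF h =>
    (mem_KosQ_iff hpres _ _).2 ⟨hF, fun i _ => one_le_tildeOf ρ i, ρ, hρ, h⟩
  have hsmall : ∀ F ∈ KosQ K n I (tildeOf n ρ), F.card ≤ k + 1 →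
      n ≤ F.card + ellInf n ρ ∧ ∀ x : Fin n, tildeOf n ρ x ≠ topVal n ρ + 1 → (x : ℕ) ∈ F :=
    fun F hF hc => subset_of_fits hF.1
      (fits_of_mem_KosQ_of_maximal hpres hρ hmax hF (by omega))
  rw [torQDim, hk, rhd0_eq_card_of_truncated K hAN hvA, ← hk, card_filter_sdiff_subset hAN hvA,
    Finset.card_map, Finset.card_range, Nat.sub_sub_self hlt.le]
  · simp
  · intro F hF hc
    have := (hsmall F hF (by omega)).1
    omega
  · intro F hc
    constructor
    · exact fun hF => ⟨(hsdiff F).2 (hsmall F hF hc.le).2, hF.1⟩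
    · exact fun h => hfits F h.2 (fits_of_subset h.2 (by omega) ((hsdiff F).1 h.1))
  · exact fun F hF => hF.1
  · exact fun F hc h1 h2 => hfits F h2 (fits_of_subset h2 (by omega) ((hsdiff F).1 h1))

end Maximal

/-! ## The order on dual generators -/

section Order

variable {n : ℕ}

lemma le_of_tildeOf_le_of_ellInf_le {ρ μ : Fin n → ℕ∞} (hρ : Antitone ρ) (hμ : Antitone μ)
    (h : ∀ i, tildeOf n ρ i ≤ tildeOf n μ i) (hell : ellInf n ρ ≤ ellInf n μ) : ρ ≤ μ := by
  intro j
  by_cases hμj : μ j = ⊤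
  · rw [hμj]
    exact le_top
  by_cases hρj : ρ j = ⊤
  · have hρs : Finset.Iic j ⊆ Finset.univ.filter fun i => ρ i = ⊤ := fun i hi =>
      Finset.mem_filter.2 ⟨Finset.mem_univ i, top_le_iff.1 (hρj ▸ hρ (Finset.mem_Iic.1 hi))⟩
    have hμs : (Finset.univ.filter fun i => μ i = ⊤) ⊆ Finset.Iio j := fun i hi =>
      Finset.mem_Iio.2 (lt_of_not_ge fun hji =>
        hμj (top_le_iff.1 ((Finset.mem_filter.1 hi).2 ▸ hμ hji)))
    have h1 := Finset.card_le_card hρs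
    have h2 := Finset.card_le_card hμs
    rw [Fin.card_Iic] at h1
    rw [Fin.card_Iio] at h2
    unfold ellInf at hell
    omega
  · have hj : (tildeOf n ρ j : ℕ∞) ≤ tildeOf n μ j := by exact_mod_cast h j
    rw [coe_tildeOf_of_ne_top hρj, coe_tildeOf_of_ne_top hμj] at hj
    exact (ENat.add_le_add_iff_right ENat.one_ne_top).1 hj

variable {K : Type} [Field K] {I : Ideal (MvPolynomial (Fin n) K)} {Λ : Finset (Fin n → ℕ∞)}

lemma ellInf_le_of_tildeOf_le (hpres : IsDualPresentation K n I Λ) {ρ μ : Fin n → ℕ∞}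
    (hρ : ρ ∈ Λ) (hμ : μ ∈ Λ) (h : ∀ i, tildeOf n ρ i ≤ tildeOf n μ i) :
    ellInf n μ ≤ ellInf n ρ := by
  by_contra! hlt
  have := eq_of_le_of_isDualPresentation hpres hρ hμ
    (le_of_tildeOf_le_of_ellInf_le (hpres.1 ρ hρ) (hpres.1 μ hμ) h hlt.le)
  exact hlt.ne (this ▸ rfl)

lemma eq_of_tildeOf_eq (hpres : IsDualPresentation K n I Λ) {ρ μ : Fin n → ℕ∞}
    (hρ : ρ ∈ Λ) (hμ : μ ∈ Λ) (h : tildeOf n ρ = tildeOf n μ) : ρ = μ :=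
  eq_of_le_of_isDualPresentation hpres hρ hμ
    (le_of_tildeOf_le_of_ellInf_le (hpres.1 ρ hρ) (hpres.1 μ hμ) (fun i => (congrFun h i).le)
      (ellInf_le_of_tildeOf_le hpres hμ hρ fun i => (congrFun h i).ge))

lemma preceq.trans {ρ μ ν : Fin n → ℕ∞} (h₁ : preceq n ρ μ) (h₂ : preceq n μ ν) :
    preceq n ρ ν :=
  ⟨fun i => (h₁.1 i).trans (h₂.1 i), h₁.2.trans h₂.2⟩

lemma exists_maximal_preceq (hpres : IsDualPresentation K n I Λ) {ρ : Fin n → ℕ∞}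
    (hρ : ρ ∈ Λ) : ∃ ρ' ∈ Λ, preceq n ρ ρ' ∧ ∀ μ ∈ Λ, preceq n ρ' μ → μ = ρ' := by
  obtain ⟨ρ', hρ', hsup⟩ := Finset.exists_max_image (Λ.filter (preceq n ρ ·))
    (fun μ => ∑ i, tildeOf n μ i) ⟨ρ, Finset.mem_filter.2 ⟨hρ, fun _ => le_rfl, le_rfl⟩⟩
  obtain ⟨hρ'Λ, hle⟩ := Finset.mem_filter.1 hρ'
  refine ⟨ρ', hρ'Λ, hle, fun μ hμ h => (eq_of_tildeOf_eq hpres hρ'Λ hμ ?_).symm⟩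
  have hsum : ∑ i, tildeOf n ρ' i = ∑ i, tildeOf n μ i :=
    (Finset.sum_le_sum fun i _ => h.1 i).antisymm
      (hsup μ (Finset.mem_filter.2 ⟨hμ, hle.trans h⟩))
  funext i
  exact (Finset.sum_eq_sum_iff_of_le fun i _ => h.1 i).1 hsum i (Finset.mem_univ i)

lemma exists_perm_of_torQDimSym_ne_zero {i : ℕ} {l : Fin n → ℕ}
    (h : torQDimSym K n I i l ≠ 0) :
    ∃ π : Equiv.Perm (Fin n), torQDim K n I i (l ∘ π) ≠ 0 := by
  obtain ⟨a, ha, h0⟩ := Finset.exists_ne_zero_of_sum_ne_zero h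
  obtain ⟨π, -, rfl⟩ := Finset.mem_image.1 ha
  exact ⟨π, h0⟩

lemma torQDim_eq_zero_of_torQDimSym_eq_zero {i : ℕ} {l : Fin n → ℕ}
    (h : torQDimSym K n I i l = 0) : torQDim K n I i l = 0 :=
  Finset.sum_eq_zero_iff.1 h l
    (Finset.mem_image.2 ⟨1, Finset.mem_univ _, funext fun _ => rfl⟩)

lemma torQDim_tildeOf_ne_zero (hne : I ≠ ⊥) (hpres : IsDualPresentation K n I Λ)
    {ρ : Fin n → ℕ∞} (hρ : ρ ∈ Λ) (hmax : ∀ μ ∈ Λ, preceq n ρ μ → μ = ρ) :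
    torQDim K n I (n - ellInf n ρ) (tildeOf n ρ) ≠ 0 := by
  rw [torQDim_tildeOf_of_maximal hne hpres hρ hmax]
  have := ellInf_lt_card (exists_ne_top_of_mem hne hpres hρ)
  exact (Nat.choose_pos (by omega)).ne'

lemma isExtremalPair_iff (hne : I ≠ ⊥) (hpres : IsDualPresentation K n I Λ) (i : ℕ)
    (l : Fin n → ℕ) :
    IsExtremalPair K n I i l ↔
      ∃ ρ ∈ Λ, (∀ μ ∈ Λ, preceq n ρ μ → μ = ρ) ∧ i = n - ellInf n ρ ∧ l = tildeOf n ρ := by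
  constructor
  · rintro ⟨hi, -, hl, hnz, hext⟩
    obtain ⟨π, hπ⟩ := exists_perm_of_torQDimSym_ne_zero hnz
    obtain ⟨ρ, hρ, hle, hell, hsum⟩ := exists_dualGenerator_of_torQDim_ne_zero hpres hi hl π hπ
    obtain ⟨ρ', hρ', hprec, hmax⟩ := exists_maximal_preceq hpres hρ
    have hell' := ellInf_le_of_tildeOf_le hpres hρ hρ' hprec.1
    have hsum' := hprec.2
    have hlρ' : l = tildeOf n ρ' := by
      by_contra hcon
      refine torQDim_tildeOf_ne_zero hne hpres hρ' hmax (torQDim_eq_zero_of_torQDimSym_eq_zero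
        (hext _ _ (by omega) (tildeOf_antitone (hpres.1 ρ' hρ'))
          (fun t => (hle t).trans (hprec.1 t)) hcon ?_))
      rw [← Nat.cast_sum, ← Nat.cast_sum]
      omega
    refine ⟨ρ', hρ', hmax, ?_, hlρ'⟩
    rw [hlρ'] at hsum
    omega
  · rintro ⟨ρ, hρ, hmax, rfl, rfl⟩
    have hlt := ellInf_lt (exists_ne_top_of_mem hne hpres hρ)
    refine ⟨by omega, Nat.sub_le _ _, tildeOf_antitone (hpres.1 ρ hρ),
      fun h => torQDim_tildeOf_ne_zero hne hpres hρ hmax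
        (torQDim_eq_zero_of_torQDimSym_eq_zero h), fun j μ hj hμ hle hneq hsum => ?_⟩
    by_contra hnz
    obtain ⟨π, hπ⟩ := exists_perm_of_torQDimSym_ne_zero hnz
    obtain ⟨ρ', hρ', hle', hell', hsum'⟩ :=
      exists_dualGenerator_of_torQDim_ne_zero hpres (by omega) hμ π hπ
    rw [← Nat.cast_sum, ← Nat.cast_sum] at hsum
    have := hmax ρ' hρ' ⟨fun t => (hle t).trans (hle' t), by omega⟩
    subst this
    exact hneq (funext fun t => (hle t).antisymm (hle' t))

end Order

/-! ## Extended partitions given by blocks -/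

section Blocks

lemma cumsum_mono (p : ℕ → ℕ) : Monotone (cumsum p) := fun _ _ h =>
  Finset.sum_le_sum_of_subset (Finset.range_subset_range.2 h)

lemma blkOf_le_iff {p : ℕ → ℕ} {s i k : ℕ} (hk : k < s) :
    blkOf p s i ≤ k ↔ i < cumsum p (k + 1) := by
  constructor
  · intro h
    by_contra! hcon
    have hsub : Finset.range (k + 1) ⊆ (Finset.range s).filter fun k => cumsum p (k + 1) ≤ i :=
      fun j hj => Finset.mem_filter.2 ⟨Finset.mem_range.2 (by have := Finset.mem_range.1 hj; omega),
        (cumsum_mono p (by have := Finset.mem_range.1 hj; omega)).trans hcon⟩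
    have := Finset.card_le_card hsub
    rw [Finset.card_range] at this
    unfold blkOf at h
    omega
  · intro h
    have hsub : ((Finset.range s).filter fun k => cumsum p (k + 1) ≤ i) ⊆ Finset.range k := by
      intro j hj
      by_contra hcon
      rw [Finset.mem_range, not_lt] at hcon
      have := cumsum_mono p (Nat.add_le_add_right hcon 1)
      have := (Finset.mem_filter.1 hj).2
      omega
    simpa [blkOf] using Finset.card_le_card hsub

variable {s : ℕ} {d p : ℕ → ℕ}

lemma rhoOf_eq_top_iff {i : ℕ} : rhoOf s d p i = ⊤ ↔ i < p 0 := by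
  have h := blkOf_le_iff (p := p) (i := i) (Nat.succ_pos s)
  rw [Nat.le_zero, cumsum, zero_add, Finset.sum_range_one] at h
  rw [← h, rhoOf]
  split_ifs with h0 <;> simp [h0]

lemma rhoOf_toNat {i : ℕ} (h : p 0 ≤ i) :
    (rhoOf s d p i).toNat = d (blkOf p (s + 1) i) := by
  have h0 : ¬ blkOf p (s + 1) i = 0 := fun h0 =>
    h.not_gt (rhoOf_eq_top_iff.1 (if_pos h0 : rhoOf s d p i = ⊤))
  rw [rhoOf, if_neg h0, ENat.toNat_natCast]

lemma lt_of_one_lt (hd : ∀ k, 1 ≤ k → k + 1 ≤ s → d (k + 1) < d k) {k : ℕ} (h1 : 1 < k)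
    (hk : k ≤ s) : d k < d 1 := by
  induction k, h1 using Nat.le_induction with
  | base => exact hd 1 le_rfl hk
  | succ k hk1 ih => exact (hd k (by omega) hk).trans (ih (by omega))

variable {n : ℕ} {ρ : Fin n → ℕ∞}

lemma ellInf_of_eq_rhoOf (hn : p 0 ≤ n) (hρ : ρ = fun i => rhoOf s d p i.val) :
    ellInf n ρ = p 0 := by
  simp only [ellInf, hρ, rhoOf_eq_top_iff]
  rw [Fin.card_filter_val_lt, min_eq_right hn]

lemma card_tildeOf_eq_of_eq_rhoOf (hs : 1 ≤ s) (hn : n = cumsum p (s + 1))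
    (hd : ∀ k, 1 ≤ k → k + 1 ≤ s → d (k + 1) < d k) (hp : ∀ k, 1 ≤ k → k ≤ s → 0 < p k)
    (hρ : ρ = fun i => rhoOf s d p i.val) :
    (Finset.univ.filter fun i => tildeOf n ρ i = topVal n ρ + 1).card = p 0 + p 1 := by
  have hc2 : cumsum p 2 = p 0 + p 1 := by simp [cumsum, Finset.sum_range_succ]
  have hle : p 0 + p 1 ≤ n := by
    rw [hn, ← hc2]
    exact cumsum_mono p (by omega)
  have hp1 := hp 1 le_rfl hs
  have hblk : ∀ i, blkOf p (s + 1) i ≤ 1 ↔ i < p 0 + p 1 := fun i => by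
    rw [← hc2]
    exact blkOf_le_iff (by omega)
  have hval : ∀ i : Fin n, p 0 ≤ (i : ℕ) →
      (ρ i).toNat ≤ d 1 ∧ ((ρ i).toNat = d 1 ↔ (i : ℕ) < p 0 + p 1) := by
    intro i hi
    have h0 : blkOf p (s + 1) i ≠ 0 := fun h0 =>
      hi.not_gt (rhoOf_eq_top_iff.1 (if_pos h0 : rhoOf s d p i = ⊤))
    rw [hρ, rhoOf_toNat hi, ← hblk]
    rcases Nat.lt_or_ge 1 (blkOf p (s + 1) i) with h1 | h1
    · have hs' : blkOf p (s + 1) i ≤ s :=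
        (blkOf_le_iff (Nat.lt_succ_self s)).2 (hn ▸ i.2)
      have := lt_of_one_lt hd h1 hs'
      omega
    · have : blkOf p (s + 1) i = 1 := by omega
      rw [this]
      simp
  have htop : ∀ i : Fin n, ρ i = ⊤ ↔ (i : ℕ) < p 0 := fun i => by
    rw [hρ]
    exact rhoOf_eq_top_iff
  have htopVal : topVal n ρ = d 1 := by
    refine le_antisymm (Finset.sup_le fun i _ => ?_) ?_
    · by_cases hi : (i : ℕ) < p 0
      · rw [(htop i).2 hi]
        exact Nat.zero_le _
      · exact (hval i (not_lt.1 hi)).1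
    · have := (hval ⟨p 0, by omega⟩ le_rfl).2.2 (by simpa using hp1)
      rw [← this]
      exact toNat_le_topVal ρ _
  have hiff : ∀ i : Fin n, tildeOf n ρ i = topVal n ρ + 1 ↔ (i : ℕ) < p 0 + p 1 := by
    intro i
    by_cases hi : (i : ℕ) < p 0
    · rw [tildeOf_of_eq_top ((htop i).2 hi)]
      simp
      omega
    · rw [tildeOf, if_neg fun h => hi ((htop i).1 h), htopVal, ← (hval i (not_lt.1 hi)).2]
      omega
  simp only [hiff]
  rw [Fin.card_filter_val_lt, min_eq_right hle]

end Blocks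

/-- For a nonzero, proper `S_n`-invariant monomial ideal `I`, the set of
extremal pairs in the Betti table of `R/I` equals `{(n - ℓ(ρ), ρ̃) : ρ ∈ Λ*_max(I)}`;
moreover, for `ρ = (∞^{p_0}, d_1^{p_1}, …, d_s^{p_s}) ∈ Λ*_max(I)`, the corresponding
extremal Betti number is `β_{n-ℓ(ρ), ρ̃}(R/I) = C(p_0 + p_1 - 1, p_0)`. -/
theorem statement_13 (K : Type) [Field K] (n : ℕ) (I : Ideal (MvPolynomial (Fin n) K))
    (hmon : IsMonomialIdeal K n I) (hsym : IsSymmetricIdeal K n I)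
    (hne : I ≠ ⊥) (hproper : I ≠ ⊤)
    (Λ : Finset (Fin n → ℕ∞)) (hpres : IsDualPresentation K n I Λ) :
    (∀ (i : ℕ) (l : Fin n → ℕ),
      IsExtremalPair K n I i l ↔
        ∃ ρ ∈ Λ, (∀ μ ∈ Λ, preceq n ρ μ → μ = ρ) ∧ i = n - ellInf n ρ ∧ l = tildeOf n ρ) ∧
    (∀ (s : ℕ) (d p : ℕ → ℕ), n = cumsum p (s + 1) →
      (∀ k, 1 ≤ k → k + 1 ≤ s → d (k + 1) < d k) →
      (∀ k, 1 ≤ k → k ≤ s → 0 < p k) →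
      ∀ ρ : Fin n → ℕ∞, ρ = (fun i => rhoOf s d p i.val) → ρ ∈ Λ →
        (∀ μ ∈ Λ, preceq n ρ μ → μ = ρ) →
        torQDim K n I (n - p 0) (tildeOf n ρ) = Nat.choose (p 0 + p 1 - 1) (p 0)) := by
  refine ⟨isExtremalPair_iff hne hpres, fun s d p hn hd hp ρ hρ hρΛ hmax => ?_⟩
  have hp0 : p 0 ≤ n := by
    have := cumsum_mono p (Nat.succ_le_succ (Nat.zero_le s))
    rwa [← hn, cumsum, Finset.sum_range_one] at this
  have hell := ellInf_of_eq_rhoOf hp0 hρ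
  have hlt := ellInf_lt (exists_ne_top_of_mem hne hpres hρΛ)
  have hs : 1 ≤ s := by
    by_contra! h0
    rw [Nat.lt_one_iff.1 h0, cumsum, zero_add, Finset.sum_range_one] at hn
    omega
  have h := torQDim_tildeOf_of_maximal hne hpres hρΛ hmax
  rwa [card_tildeOf_eq_of_eq_rhoOf hs hn hd hp hρ, hell] at h
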